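/- arXiv:1405.5369 — 2 statements merged into one kernel-verified Lean document; each statement's English description precedes it below -/
import Mathlib

section
/- Let d ≥ 2 and let Σ₁ : U₁ → ℝ^d and Σ₂ : U₂ → ℝ^d be smooth immersions on compact sets U₁, U₂ ⊆ ℝ^{d-1}, with unit normals ν_{Σ₁}, ν_{Σ₂}. Suppose the two parametrised hypersurfaces are transversal in the sense that √(1 − ⟨ν_{Σ₁}(x₁), ν_{Σ₂}(x₂)⟩²) ≥ c for all x₁ ∈ U₁, x₂ ∈ U₂ and some c > 0. Then there is a constant C (depending on d, c, Σ₁, Σ₂) such that ‖E₁g₁ · E₂g₂‖_{L^2(ℝ^d)} ≤ C ‖g₁‖_{L^2(U₁)} ‖g₂‖_{L^2(U₂)} for all g₁ ∈ L^2(U₁), g₂ ∈ L^2(U₂). -/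
open MeasureTheory Metric Complex
open scoped InnerProductSpace ENNReal

/-- The extension operator associated with a parametrised hypersurface
`Σ : U → ℝ^d`, `U ⊆ ℝ^{d-1}`:  `Eg(ξ) = ∫_U g(x) e^{i ξ·Σ(x)} dx`. -/
noncomputable def extOp {n : ℕ} (U : Set (EuclideanSpace ℝ (Fin n)))
    (S : EuclideanSpace ℝ (Fin n) → EuclideanSpace ℝ (Fin (n + 1)))
    (g : EuclideanSpace ℝ (Fin n) → ℂ) (ξ : EuclideanSpace ℝ (Fin (n + 1))) : ℂ :=
  ∫ x in U, Complex.exp (Complex.I * (⟪ξ, S x⟫_ℝ : ℂ)) * g x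

open Set Filter
open scoped Topology NNReal FourierTransform

section Pushforward

variable {E F : Type*} [NormedAddCommGroup E] [NormedSpace ℝ E] [FiniteDimensional ℝ E]
  [MeasurableSpace E] [BorelSpace E] [NormedAddCommGroup F] [NormedSpace ℝ F]
  [FiniteDimensional ℝ F] [MeasurableSpace F] [BorelSpace F]
  (μ : Measure E) [μ.IsAddHaarMeasure] (ν : Measure F) [ν.IsAddHaarMeasure]

/-- The preimage of a set under a surjective linear map, cut off to a bounded set, has measure
controlled by the measure of the set. -/
theorem ContinuousLinearMap.exists_measure_preimage_inter_closedBall_le (D : E →L[ℝ] F)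
    (R : F →L[ℝ] E) (hDR : ∀ y, D (R y) = y) (r : ℝ) :
    ∃ C : ℝ≥0, ∀ A : Set F, μ (D ⁻¹' A ∩ closedBall 0 r) ≤ C * ν A := by
  let K : Submodule ℝ E := LinearMap.ker (D : E →ₗ[ℝ] F)
  have hK : ∀ x, x - R (D x) ∈ K := fun x => by simp [K, hDR]
  let e : E ≃ₗ[ℝ] F × K :=
    { toFun := fun x => (D x, ⟨x - R (D x), hK x⟩)
      map_add' := fun x y => by
        ext <;> simp
        abel
      map_smul' := fun c x => by ext <;> simp [smul_sub]
      invFun := fun q => R q.1 + q.2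
      left_inv := fun x => by simp
      right_inv := fun q => by
        have : D (q.2 : E) = 0 := q.2.2
        ext <;> simp [hDR, this] }
  let κ : Measure K := Measure.addHaar
  let E' := e.toContinuousLinearEquiv
  have hhaar : (μ.map E').IsAddHaarMeasure := E'.isAddHaarMeasure_map μ
  obtain ⟨c, hc⟩ : ∃ c : ℝ≥0, μ.map E' = c • ν.prod κ :=
    ⟨_, Measure.isAddLeftInvariant_eq_smul _ _⟩
  let B : Set K := (fun q : F × K => q.2) '' (E' '' closedBall 0 r)
  have hB : IsCompact B :=
    ((isCompact_closedBall 0 r).image E'.continuous).image continuous_snd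
  refine ⟨c * (κ B).toNNReal, fun A => ?_⟩
  calc μ (D ⁻¹' A ∩ closedBall 0 r) ≤ μ (E' ⁻¹' (A ×ˢ B)) := by
        refine measure_mono fun x hx => ⟨hx.1, ?_⟩
        exact ⟨E' x, ⟨x, hx.2, rfl⟩, rfl⟩
    _ = μ.map E' (A ×ˢ B) := (E'.toHomeomorph.toMeasurableEquiv.map_apply _).symm
    _ = ↑(c * (κ B).toNNReal) * ν A := by
        rw [hc, Measure.smul_apply, Measure.prod_prod, ENNReal.coe_mul,
          ENNReal.coe_toNNReal hB.measure_lt_top.ne, ENNReal.smul_def, smul_eq_mul]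
        ring

/-- Near a point where a map is a strict submersion, it pushes Lebesgue measure forward to a
measure with bounded density. -/
theorem HasStrictFDerivAt.exists_map_restrict_le {Φ : E → F} {D : E →L[ℝ] F} {p : E}
    (hΦ : HasStrictFDerivAt Φ D p) (hD : Function.Surjective D) (hm : Measurable Φ) :
    ∃ s ∈ 𝓝 p, ∃ C : ℝ≥0, (μ.restrict s).map Φ ≤ C • ν := by
  obtain ⟨R, hR⟩ := (D : E →ₗ[ℝ] F).exists_rightInverse_of_surjective
    (LinearMap.range_eq_top.2 hD)
  let R' : F →L[ℝ] E := R.toContinuousLinearMap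
  have hDR : ∀ y, D (R' y) = y := fun y => LinearMap.congr_fun hR y
  let T : E → E := fun x => x - R' (D x) + R' (Φ x)
  have hT : HasStrictFDerivAt T (ContinuousLinearMap.id ℝ E) p := by
    have h := ((hasStrictFDerivAt_id p).sub (R'.comp D).hasStrictFDerivAt).add
      (R'.hasStrictFDerivAt.comp p hΦ)
    simpa [T, Function.comp_def] using! h
  have hDT : ∀ x, D (T x) = Φ x := fun x => by simp [T, hDR]
  obtain ⟨δ, hδ, hδ0⟩ := ((mul_le_addHaar_image_of_lt_det μ (ContinuousLinearMap.id ℝ E)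
    (m := 2⁻¹) (by
      simp [ContinuousLinearMap.det])).and self_mem_nhdsWithin).exists
  obtain ⟨s, hs, hTs⟩ := hT.approximates_deriv_on_nhds (Or.inr hδ0)
  obtain ⟨C, hC⟩ := D.exists_measure_preimage_inter_closedBall_le μ ν R' hDR (‖T p‖ + 1)
  have hnear : T ⁻¹' closedBall 0 (‖T p‖ + 1) ∈ 𝓝 p :=
    hT.continuousAt.preimage_mem_nhds
      (mem_of_superset (ball_mem_nhds (T p) one_pos) fun y hy => by
        rw [mem_ball, dist_eq_norm] at hy
        rw [mem_closedBall_zero_iff]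
        linarith [norm_le_norm_add_norm_sub' y (T p)])
  refine ⟨s ∩ T ⁻¹' closedBall 0 (‖T p‖ + 1), inter_mem hs hnear, 2 * C, ?_⟩
  refine Measure.le_iff.2 fun A hA => ?_
  rw [Measure.map_apply hm hA, Measure.restrict_apply (hm hA)]
  set W := Φ ⁻¹' A ∩ (s ∩ T ⁻¹' closedBall 0 (‖T p‖ + 1))
  have h1 := hδ W T (hTs.mono_set fun x hx => hx.2.1)
  have h2 : T '' W ⊆ D ⁻¹' A ∩ closedBall 0 (‖T p‖ + 1) := by
    rintro _ ⟨x, hx, rfl⟩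
    exact ⟨by simpa [hDT] using hx.1, hx.2.2⟩
  calc μ W = 2 * (((2⁻¹ : ℝ≥0) : ℝ≥0∞) * μ W) := by
        rw [← mul_assoc, ENNReal.coe_inv two_ne_zero, ENNReal.coe_ofNat,
          ENNReal.mul_inv_cancel two_ne_zero ENNReal.ofNat_ne_top, one_mul]
    _ ≤ 2 * (C * ν A) := by
        gcongr 2 * ?_
        exact h1.trans ((measure_mono h2).trans (hC A))
    _ = ((2 * C : ℝ≥0) • ν) A := by
        rw [Measure.smul_apply, ENNReal.smul_def, smul_eq_mul, ENNReal.coe_mul, mul_assoc]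
        simp

/-- A map which is submersive along a compact set pushes Lebesgue measure on this set forward to
a measure with bounded density. -/
theorem IsCompact.exists_map_restrict_le {Φ : E → F} {K : Set E} (hK : IsCompact K)
    (hΦ : ContDiff ℝ 1 Φ) (hD : ∀ p ∈ K, Function.Surjective (fderiv ℝ Φ p)) :
    ∃ C : ℝ≥0, (μ.restrict K).map Φ ≤ C • ν := by
  have hm : Measurable Φ := hΦ.continuous.measurable
  refine hK.induction_on (p := fun s => ∃ C : ℝ≥0, (μ.restrict s).map Φ ≤ C • ν)
    ⟨0, by simp⟩ ?_ ?_ ?_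
  · rintro s t hst ⟨C, hC⟩
    exact ⟨C, (Measure.map_mono (Measure.restrict_mono_set μ hst) hm).trans hC⟩
  · rintro s t ⟨C, hC⟩ ⟨C', hC'⟩
    refine ⟨C + C', (Measure.map_mono (Measure.restrict_union_le s t) hm).trans ?_⟩
    rw [Measure.map_add _ _ hm, add_smul]
    exact add_le_add hC hC'
  · intro p hp
    obtain ⟨s, hs, hC⟩ := (hΦ.contDiffAt.hasStrictFDerivAt one_ne_zero).exists_map_restrict_le
      μ ν (hD p hp) hm
    exact ⟨s, mem_nhdsWithin_of_mem_nhds hs, hC⟩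

end Pushforward

section Fourier

open SchwartzMap FourierTransform
open scoped ContDiff

variable {V : Type*} [NormedAddCommGroup V] [InnerProductSpace ℝ V] [FiniteDimensional ℝ V]
  [MeasurableSpace V] [BorelSpace V]

theorem continuous_fourier_of_integrable {φ : V → ℂ} (h1 : Integrable φ) : Continuous (𝓕 φ) :=
  VectorFourier.fourierIntegral_continuous Real.continuous_fourierChar
    (L := innerₗ V) continuous_inner h1

/-- The Fourier integral of a function in `L¹ ∩ L²` agrees with its `L²` Fourier transform. -/
theorem MeasureTheory.MemLp.fourier_toLp_ae_eq {φ : V → ℂ} (h1 : Integrable φ)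
    (h2 : MemLp φ 2) : 𝓕 φ =ᵐ[volume] (𝓕 h2.toLp : Lp ℂ 2 (volume : Measure V)) := by
  refine ae_eq_of_integral_contDiff_smul_eq
    (continuous_fourier_of_integrable h1).locallyIntegrable
    ((Lp.memLp _).locallyIntegrable one_le_two) fun g hg hgc => ?_
  let ψ : 𝓢(V, ℂ) := (hgc.comp_left (g := ((↑) : ℝ → ℂ)) ofReal_zero).toSchwartzMap
    (ofRealCLM.contDiff.comp hg)
  have hψ : ∀ x, ψ x = (g x : ℂ) := fun x => rfl
  have key := congrArg (fun T => T ψ) (Lp.fourier_toTemperedDistribution_eq h2.toLp)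
  simp only [TemperedDistribution.fourier_apply, Lp.toTemperedDistribution_apply] at key
  calc ∫ x, g x • 𝓕 φ x = ∫ x, ψ x • 𝓕 φ x := by simp [hψ]
    _ = ∫ x, 𝓕 (ψ : V → ℂ) x • φ x := by
        have := VectorFourier.integral_fourierIntegral_smul_eq_flip (μ := volume) (ν := volume)
          (e := Real.fourierChar) (L := innerₗ V) (f := ψ) (g := φ) Real.continuous_fourierChar
          continuous_inner ψ.integrable h1
        rw [flip_innerₗ] at this
        exact this.symm
    _ = ∫ x, (𝓕 ψ) x • (h2.toLp φ : V → ℂ) x := by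
        refine integral_congr_ae ?_
        filter_upwards [h2.coeFn_toLp] with x hx
        rw [hx, SchwartzMap.fourier_coe]
    _ = _ := by
        rw [key]
        simp [hψ]

/-- Plancherel's theorem on `L¹ ∩ L²`. -/
theorem MeasureTheory.MemLp.eLpNorm_fourier_eq {φ : V → ℂ} (h1 : Integrable φ)
    (h2 : MemLp φ 2) : eLpNorm (𝓕 φ) 2 = eLpNorm φ 2 := by
  rw [eLpNorm_congr_ae (h2.fourier_toLp_ae_eq h1), ← eLpNorm_congr_ae h2.coeFn_toLp,
    ← Lp.enorm_def, ← Lp.enorm_def, enorm_eq_iff_norm_eq, Lp.norm_fourier_eq]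

/-- If the pushforward of `μ` under `Φ` has density at most `C`, then the extension operator
associated with `Φ` is bounded from `L²(μ)` to `L²` with norm at most `√C`. -/
theorem eLpNorm_integral_fourierChar_le {X : Type*} [MeasurableSpace X] {μ : Measure X}
    [IsFiniteMeasure μ] {Φ : X → V} (hΦ : Measurable Φ) {C : ℝ≥0}
    (hC : μ.map Φ ≤ C • (volume : Measure V)) {f : X → ℂ} (hf : MemLp f 2 μ) :
    eLpNorm (fun ξ => ∫ p, 𝐞 (-⟪ξ, Φ p⟫_ℝ) • f p ∂μ) 2 ≤
      (C : ℝ≥0∞) ^ (1 / 2 : ℝ) * eLpNorm f 2 μ := by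
  set G : V → ℂ := fun ξ => ∫ p, 𝐞 (-⟪ξ, Φ p⟫_ℝ) • f p ∂μ with hG
  have hf1 : Integrable f μ := hf.integrable one_le_two
  have hker : Measurable fun q : V × X => ((𝐞 (-⟪q.1, Φ q.2⟫_ℝ) : Circle) : ℂ) :=
    (continuous_induced_dom.comp Real.continuous_fourierChar).measurable.comp
      (measurable_fst.inner (hΦ.comp measurable_snd)).neg
  have hGb : ∀ ξ, ‖G ξ‖ ≤ ∫ p, ‖f p‖ ∂μ := fun ξ =>
    (norm_integral_le_integral_norm _).trans_eq (by simp_rw [Circle.norm_smul])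
  have hGm : AEStronglyMeasurable G volume :=
    AEStronglyMeasurable.integral_prod_right' (f := fun q : V × X =>
      𝐞 (-⟪q.1, Φ q.2⟫_ℝ) • f q.2) (hker.aestronglyMeasurable.mul hf1.1.comp_snd)
  have hGi : ∀ N : ℕ, ∀ p, MemLp ((closedBall (0 : V) N).indicator G) p := fun N p => by
    rw [memLp_indicator_iff_restrict measurableSet_closedBall]
    have : IsFiniteMeasure (volume.restrict (closedBall (0 : V) N)) :=
      ⟨by simpa using measure_closedBall_lt_top⟩
    exact MemLp.of_bound hGm.restrict _ (ae_of_all _ hGb)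
  have hbound : ∀ N : ℕ, eLpNorm ((closedBall (0 : V) N).indicator G) 2 ≤
      (C : ℝ≥0∞) ^ (1 / 2 : ℝ) * eLpNorm f 2 μ := fun N => by
    set H := (closedBall (0 : V) N).indicator G with hH
    let φ : V → ℂ := fun ξ => star (H ξ)
    have hφ : ∀ p, MemLp φ p := fun p => (hGi N p).star
    have hφ1 : Integrable φ := memLp_one_iff_integrable.1 (hφ 1)
    have hφH : eLpNorm φ 2 = eLpNorm H 2 := eLpNorm_congr_norm_ae (ae_of_all _ fun ξ => by simp [φ])
    have hdual : ∫ ξ, G ξ * φ ξ = ∫ p, f p * 𝓕 φ (Φ p) ∂μ := by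
      simp_rw [hG, Circle.smul_def, smul_eq_mul, ← integral_mul_const, Real.fourier_eq, ← integral_const_mul]
      rw [integral_integral_swap]
      · refine integral_congr_ae (ae_of_all _ fun p => integral_congr_ae (ae_of_all _ fun ξ => ?_))
        simp only [Circle.smul_def, smul_eq_mul]
        ring
      · refine ((hφ1.mul_prod hf1).bdd_mul (c := 1) hker.aestronglyMeasurable
          (ae_of_all _ fun q => (Circle.norm_coe _).le)).congr (ae_of_all _ fun q => ?_)
        exact mul_left_comm _ _ _ |>.trans (mul_comm _ _)
    have hsq : eLpNorm H 2 ^ 2 = ‖∫ ξ, G ξ * φ ξ‖ₑ := by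
      have hpt : ∀ ξ, G ξ * φ ξ = ((‖H ξ‖ ^ 2 : ℝ) : ℂ) := fun ξ => by
        by_cases h : ξ ∈ closedBall (0 : V) N
        · simp [φ, hH, indicator_of_mem h, Complex.mul_conj, Complex.normSq_eq_norm_sq]
        · simp [φ, hH, indicator_of_notMem h]
      have h0 : 0 ≤ ∫ ξ, ‖H ξ‖ ^ 2 := integral_nonneg fun ξ => by positivity
      rw [integral_congr_ae (ae_of_all _ hpt), integral_complex_ofReal, ← ofReal_norm,
        Complex.norm_real, Real.norm_of_nonneg h0,
        (hGi N 2).eLpNorm_eq_integral_rpow_norm two_ne_zero ENNReal.ofNat_ne_top,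
        ← ENNReal.ofReal_pow (by positivity), ← Real.rpow_natCast, ← Real.rpow_mul (by positivity)]
      simp [hH]
    have hle : ‖∫ p, f p * 𝓕 φ (Φ p) ∂μ‖ₑ ≤
        eLpNorm f 2 μ * ((C : ℝ≥0∞) ^ (1 / 2 : ℝ) * eLpNorm H 2) := by
      have hcont : Continuous (𝓕 φ) := continuous_fourier_of_integrable hφ1
      have h2 : eLpNorm (𝓕 φ ∘ Φ) 2 μ ≤ (C : ℝ≥0∞) ^ (1 / 2 : ℝ) * eLpNorm H 2 := by
        rw [← eLpNorm_map_measure hcont.aestronglyMeasurable hΦ.aemeasurable]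
        refine (eLpNorm_mono_measure _ hC).trans_eq ?_
        rw [eLpNorm_smul_measure_of_ne_top' ENNReal.ofNat_ne_top, (hφ 2).eLpNorm_fourier_eq hφ1,
          hφH]
        simp [ENNReal.smul_def, ENNReal.coe_rpow_of_nonneg]
      calc ‖∫ p, f p * 𝓕 φ (Φ p) ∂μ‖ₑ ≤ ∫⁻ p, ‖f p * 𝓕 φ (Φ p)‖ₑ ∂μ :=
            enorm_integral_le_lintegral_enorm _
        _ = eLpNorm (f • (𝓕 φ ∘ Φ)) 1 μ := by simp [eLpNorm_one_eq_lintegral_enorm]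
        _ ≤ eLpNorm f 2 μ * eLpNorm (𝓕 φ ∘ Φ) 2 μ :=
            eLpNorm_smul_le_mul_eLpNorm (hcont.measurable.comp hΦ).aestronglyMeasurable hf.1
        _ ≤ _ := by gcongr
    rcases eq_or_ne (eLpNorm H 2) 0 with h0 | h0
    · simp [h0]
    · have hfin : eLpNorm H 2 ≠ ⊤ := (hGi N 2).eLpNorm_ne_top
      refine (ENNReal.mul_le_mul_iff_left h0 hfin).1 ?_
      rw [← sq, hsq, hdual]
      refine hle.trans_eq ?_
      ring
  refine Lp.eLpNorm_le_of_ae_tendsto (u := atTop) (f := fun N : ℕ =>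
    (closedBall (0 : V) N).indicator G) (Eventually.of_forall hbound)
    (fun N => (hGi N 2).1) (ae_of_all _ fun ξ => ?_)
  refine tendsto_const_nhds.congr' ?_
  filter_upwards [eventually_ge_atTop ⌈‖ξ‖⌉₊] with N hN
  rw [indicator_of_mem]
  simpa using Nat.ceil_le.1 hN

end Fourier

/-- A unit normal of a hyperplane, given as the range of an injective linear map, spans its
orthogonal complement. -/
theorem ContinuousLinearMap.exists_smul_eq_of_orthogonal_range {P F : Type*}
    [NormedAddCommGroup P] [NormedSpace ℝ P] [NormedAddCommGroup F] [InnerProductSpace ℝ F]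
    [FiniteDimensional ℝ F] (A : P →L[ℝ] F)
    (hP : Module.finrank ℝ F = Module.finrank ℝ P + 1) (hA : Function.Injective A) {u w : F} (hu : ‖u‖ = 1) (huA : ∀ v, ⟪u, A v⟫_ℝ = 0)
    (hwA : ∀ v, ⟪w, A v⟫_ℝ = 0) : ∃ c : ℝ, c • u = w := by
  let K : Submodule ℝ F := LinearMap.range (A : P →ₗ[ℝ] F)
  have hmem : ∀ z : F, (∀ v, ⟪z, A v⟫_ℝ = 0) → z ∈ Kᗮ := fun z hz => by
    rw [Submodule.mem_orthogonal']
    rintro _ ⟨v, rfl⟩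
    exact hz v
  have h1 : Module.finrank ℝ Kᗮ = 1 := by
    have h := K.finrank_add_finrank_orthogonal
    have h' : Module.finrank ℝ K = Module.finrank ℝ P := LinearMap.finrank_range_of_inj hA
    omega
  have hu0 : (⟨u, hmem u huA⟩ : Kᗮ) ≠ 0 := fun h => by
    have : u = 0 := congrArg Subtype.val h
    simp [this] at hu
  obtain ⟨c, hc⟩ := (finrank_eq_one_iff_of_nonzero' _ hu0).1 h1 ⟨w, hmem w hwA⟩
  exact ⟨c, congrArg Subtype.val hc⟩

/-- The sum of the tangent spaces of two hypersurfaces is everything as soon as their unit normals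
are not parallel. -/
theorem ContinuousLinearMap.surjective_coprod_of_inner_sq_ne_one {P Q F : Type*}
    [NormedAddCommGroup P] [NormedSpace ℝ P] [NormedAddCommGroup Q] [NormedSpace ℝ Q]
    [NormedAddCommGroup F] [InnerProductSpace ℝ F] [FiniteDimensional ℝ F]
    (hP : Module.finrank ℝ F = Module.finrank ℝ P + 1)
    (hQ : Module.finrank ℝ F = Module.finrank ℝ Q + 1)
    {A : P →L[ℝ] F} {B : Q →L[ℝ] F} (hA : Function.Injective A) (hB : Function.Injective B)
    {a b : F} (ha : ‖a‖ = 1) (hb : ‖b‖ = 1) (haA : ∀ v, ⟪a, A v⟫_ℝ = 0)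
    (hbB : ∀ v, ⟪b, B v⟫_ℝ = 0) (hab : ⟪a, b⟫_ℝ ^ 2 ≠ 1) :
    Function.Surjective (A.coprod B) := by
  by_contra hsurj
  have hne : LinearMap.range (A.coprod B : P × Q →ₗ[ℝ] F) ≠ ⊤ := fun h =>
    hsurj (LinearMap.range_eq_top.1 h)
  obtain ⟨w, hw, hw0⟩ := Submodule.exists_mem_ne_zero_of_ne_bot
    (fun h => hne ((Submodule.orthogonal_eq_bot_iff).1 h))
  rw [Submodule.mem_orthogonal'] at hw
  obtain ⟨s, rfl⟩ := A.exists_smul_eq_of_orthogonal_range hP hA ha haA fun v => by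
    simpa using hw (A v) ⟨(v, 0), by simp⟩
  obtain ⟨t, ht⟩ := B.exists_smul_eq_of_orthogonal_range hQ hB hb hbB (w := s • a) fun v => by
    simpa using hw (B v) ⟨(0, v), by simp⟩
  have hs : s ≠ 0 := fun h => hw0 (by simp [h])
  have h1 : t * ⟪a, b⟫_ℝ = s := by
    have := congrArg (fun z => ⟪a, z⟫_ℝ) ht
    simpa [inner_smul_right, ha] using this
  have h2 : |t| = |s| := by simpa [norm_smul, ha, hb] using congrArg norm ht
  have h3 : t ^ 2 = s ^ 2 := sq_eq_sq_iff_abs_eq_abs t s |>.2 h2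
  refine hab (mul_left_cancel₀ (pow_ne_zero 2 hs) ?_)
  rw [← h3, ← mul_pow, h1, h3, mul_one]

/-- The `L²` norm of a tensor product is the product of the `L²` norms. -/
theorem MeasureTheory.eLpNorm_two_mul_prod {X Y : Type*} [MeasurableSpace X] [MeasurableSpace Y]
    {μ : Measure X} {ν : Measure Y} [SFinite ν] {f : X → ℂ} {g : Y → ℂ}
    (hf : AEStronglyMeasurable f μ) (hg : AEStronglyMeasurable g ν) :
    eLpNorm (fun p : X × Y => f p.1 * g p.2) 2 (μ.prod ν) = eLpNorm f 2 μ * eLpNorm g 2 ν := by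
  simp_rw [eLpNorm_eq_lintegral_rpow_enorm_toReal two_ne_zero ENNReal.ofNat_ne_top, enorm_mul]
  simp_rw [ENNReal.mul_rpow_of_nonneg _ _ ENNReal.toReal_nonneg]
  rw [lintegral_prod_mul (hf.enorm.pow_const _) (hg.enorm.pow_const _),
    ENNReal.mul_rpow_of_nonneg _ _ (by simp)]

section extOp

variable {n : ℕ} {U : Set (EuclideanSpace ℝ (Fin n))}
  {S : EuclideanSpace ℝ (Fin n) → EuclideanSpace ℝ (Fin (n + 1))}
  {g : EuclideanSpace ℝ (Fin n) → ℂ}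

theorem extOp_eq_zero_of_not_aestronglyMeasurable (hS : Continuous S)
    (hg : ¬ AEStronglyMeasurable g (volume.restrict U)) : extOp U S g = 0 := by
  funext ξ
  refine integral_undef fun h => hg ?_
  have hc : Continuous fun x => Complex.exp (-(Complex.I * (⟪ξ, S x⟫_ℝ : ℂ))) := by fun_prop
  refine (hc.aestronglyMeasurable.mul h.1).congr (ae_of_all _ fun x => ?_)
  simp [← mul_assoc, ← Complex.exp_add]

end extOp

/-- Bilinear L²×L² → L² extension estimate for two transversal hypersurfaces in `ℝ^d`
(`d = n+1 ≥ 2`); no curvature hypothesis.  The smooth immersions `S₁, S₂` on compact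
sets `U₁, U₂` carry unit normal fields `ν₁, ν₂`, and transversality means
`√(1 − ⟨ν₁(x₁), ν₂(x₂)⟩²) ≥ c` for all `x₁ ∈ U₁`, `x₂ ∈ U₂`. -/
theorem bilinear_extension_L2 (n : ℕ) (hn : 1 ≤ n) (c : ℝ) (hc : 0 < c)
    (U₁ U₂ : Set (EuclideanSpace ℝ (Fin n))) (hU₁ : IsCompact U₁) (hU₂ : IsCompact U₂)
    (S₁ S₂ : EuclideanSpace ℝ (Fin n) → EuclideanSpace ℝ (Fin (n + 1)))
    (hS₁ : ContDiff ℝ (⊤ : ℕ∞) S₁) (hS₂ : ContDiff ℝ (⊤ : ℕ∞) S₂)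
    (hS₁imm : ∀ x ∈ U₁, Function.Injective (fderiv ℝ S₁ x))
    (hS₂imm : ∀ x ∈ U₂, Function.Injective (fderiv ℝ S₂ x))
    (ν₁ ν₂ : EuclideanSpace ℝ (Fin n) → EuclideanSpace ℝ (Fin (n + 1)))
    (hν₁unit : ∀ x ∈ U₁, ‖ν₁ x‖ = 1) (hν₂unit : ∀ x ∈ U₂, ‖ν₂ x‖ = 1)
    (hν₁perp : ∀ x ∈ U₁, ∀ v, ⟪ν₁ x, fderiv ℝ S₁ x v⟫_ℝ = 0)
    (hν₂perp : ∀ x ∈ U₂, ∀ v, ⟪ν₂ x, fderiv ℝ S₂ x v⟫_ℝ = 0)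
    (htrans : ∀ x₁ ∈ U₁, ∀ x₂ ∈ U₂, c ≤ Real.sqrt (1 - ⟪ν₁ x₁, ν₂ x₂⟫_ℝ ^ 2)) :
    ∃ C > 0, ∀ g₁ g₂ : EuclideanSpace ℝ (Fin n) → ℂ,
      eLpNorm (fun ξ => extOp U₁ S₁ g₁ ξ * extOp U₂ S₂ g₂ ξ) 2 volume
        ≤ ENNReal.ofReal C * (eLpNorm g₁ 2 (volume.restrict U₁) *
            eLpNorm g₂ 2 (volume.restrict U₂)) := by
  let Φ : EuclideanSpace ℝ (Fin n) × EuclideanSpace ℝ (Fin n) → EuclideanSpace ℝ (Fin (n + 1)) :=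
    fun p => (-(2 * Real.pi)⁻¹) • (S₁ p.1 + S₂ p.2)
  have h2π : (-(2 * Real.pi)⁻¹) ≠ 0 := neg_ne_zero.2 (inv_ne_zero Real.two_pi_pos.ne')
  have hΦ : ContDiff ℝ 1 Φ := by
    have h₁ : ContDiff ℝ 1 S₁ := hS₁.of_le (by exact_mod_cast le_top)
    have h₂ : ContDiff ℝ 1 S₂ := hS₂.of_le (by exact_mod_cast le_top)
    fun_prop
  have hsurj : ∀ p ∈ U₁ ×ˢ U₂, Function.Surjective (fderiv ℝ Φ p) := by
    rintro ⟨x, y⟩ ⟨hx, hy⟩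
    have hd₁ : HasFDerivAt S₁ (fderiv ℝ S₁ x) x :=
      (hS₁.differentiable (by simp)).differentiableAt.hasFDerivAt
    have hd₂ : HasFDerivAt S₂ (fderiv ℝ S₂ y) y :=
      (hS₂.differentiable (by simp)).differentiableAt.hasFDerivAt
    have hd : HasFDerivAt Φ ((-(2 * Real.pi)⁻¹) •
        (fderiv ℝ S₁ x).coprod (fderiv ℝ S₂ y)) (x, y) := by
      rw [← ContinuousLinearMap.comp_fst_add_comp_snd]
      exact ((hd₁.comp (x, y) hasFDerivAt_fst).add
        (HasFDerivAt.comp (f := Prod.snd) (g := S₂) (x, y) hd₂ hasFDerivAt_snd)).const_smul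
        (-(2 * Real.pi)⁻¹)
    rw [hd.fderiv]
    have hcop : Function.Surjective ((fderiv ℝ S₁ x).coprod (fderiv ℝ S₂ y)) :=
      ContinuousLinearMap.surjective_coprod_of_inner_sq_ne_one (by simp) (by simp)
        (hS₁imm x hx) (hS₂imm y hy) (hν₁unit x hx) (hν₂unit y hy) (hν₁perp x hx) (hν₂perp y hy)
        fun h => by
          have := htrans x hx y hy
          rw [h, sub_self, Real.sqrt_zero] at this
          exact hc.not_ge this
    intro z
    obtain ⟨q, hq⟩ := hcop ((-(2 * Real.pi)⁻¹)⁻¹ • z)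
    exact ⟨q, by rw [smul_apply, hq, smul_inv_smul₀ h2π]⟩
  obtain ⟨C, hC⟩ := (hU₁.prod hU₂).exists_map_restrict_le (volume.prod volume) volume hΦ hsurj
  rw [← Measure.prod_restrict] at hC
  have hfin₁ : IsFiniteMeasure (volume.restrict U₁) := ⟨by simpa using hU₁.measure_lt_top⟩
  have hfin₂ : IsFiniteMeasure (volume.restrict U₂) := ⟨by simpa using hU₂.measure_lt_top⟩
  have hpos : (0 : ℝ) < (C : ℝ) ^ (1 / 2 : ℝ) + 1 := by positivity
  refine ⟨(C : ℝ) ^ (1 / 2 : ℝ) + 1, hpos, fun g₁ g₂ => ?_⟩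
  by_cases hz₁ : extOp U₁ S₁ g₁ = 0
  · simp [hz₁]
  by_cases hz₂ : extOp U₂ S₂ g₂ = 0
  · simp [hz₂]
  have hm₁ : AEStronglyMeasurable g₁ (volume.restrict U₁) := by
    by_contra h
    exact hz₁ (extOp_eq_zero_of_not_aestronglyMeasurable hS₁.continuous h)
  have hm₂ : AEStronglyMeasurable g₂ (volume.restrict U₂) := by
    by_contra h
    exact hz₂ (extOp_eq_zero_of_not_aestronglyMeasurable hS₂.continuous h)
  have hprod := eLpNorm_two_mul_prod hm₁ hm₂
  rcases eq_or_ne (eLpNorm g₁ 2 (volume.restrict U₁) * eLpNorm g₂ 2 (volume.restrict U₂)) ⊤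
    with htop | htop
  · rw [htop, ENNReal.mul_top (ENNReal.ofReal_pos.2 hpos).ne']
    exact le_top
  have hmem : MemLp (fun p : EuclideanSpace ℝ (Fin n) × EuclideanSpace ℝ (Fin n) =>
      g₁ p.1 * g₂ p.2) 2 ((volume.restrict U₁).prod (volume.restrict U₂)) :=
    ⟨hm₁.comp_fst.mul hm₂.comp_snd, by rw [hprod]; exact htop.lt_top⟩
  have hext : (fun ξ => extOp U₁ S₁ g₁ ξ * extOp U₂ S₂ g₂ ξ) = fun ξ =>
      ∫ p, 𝐞 (-⟪ξ, Φ p⟫_ℝ) • (g₁ p.1 * g₂ p.2)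
        ∂((volume.restrict U₁).prod (volume.restrict U₂)) := by
    funext ξ
    rw [extOp, extOp, ← integral_prod_mul]
    refine integral_congr_ae (ae_of_all _ fun p => ?_)
    have hker : (𝐞 (-⟪ξ, Φ p⟫_ℝ) : ℂ) = Complex.exp (Complex.I * (⟪ξ, S₁ p.1⟫_ℝ : ℂ)) *
        Complex.exp (Complex.I * (⟪ξ, S₂ p.2⟫_ℝ : ℂ)) := by
      rw [Real.fourierChar_apply, ← Complex.exp_add]
      congr 1
      have hπ : (Real.pi : ℂ) ≠ 0 := ofReal_ne_zero.2 Real.pi_ne_zero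
      simp only [Φ, inner_smul_right, inner_add_right]
      push_cast
      field_simp
    simp only [Circle.smul_def, smul_eq_mul, hker]
    ring
  rw [hext, ← hprod]
  refine (eLpNorm_integral_fourierChar_le hΦ.continuous.measurable hC hmem).trans ?_
  gcongr
  rw [← ENNReal.ofReal_coe_nnreal, ENNReal.ofReal_rpow_of_nonneg C.coe_nonneg (by norm_num)]
  exact ENNReal.ofReal_le_ofReal (le_add_of_nonneg_right zero_le_one)
end

section
/- Let d ≥ 2, c > 0 and q ≥ d/(d-1). Let 𝕋₁, …, 𝕋_d be finite families of doubly-infinite δ-tubes in ℝ^d that are c-transversal, i.e. |det(e(T₁), …, e(T_d))| ≥ c for all choices T_j ∈ 𝕋_j. Then there is a constant C depending only on d, q and c (in particular independent of δ and of the families) such that ( ∫_{ℝ^d} ∏_{j=1}^d ( ∑_{T ∈ 𝕋_j} χ_T )^{q/d} )^{d/q} ≤ C ∏_{j=1}^d δ^{d/q} · #𝕋_j. -/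
open MeasureTheory Metric
open scoped InnerProductSpace ENNReal

/-- The doubly-infinite `δ`-tube in `ℝ^d` around the line through `a` with unit
direction `e`: the set of points at distance at most `δ` from the line. -/
noncomputable def infTube {d : ℕ} (δ : ℝ) (a e : EuclideanSpace ℝ (Fin d)) :
    Set (EuclideanSpace ℝ (Fin d)) :=
  {x | ‖(x - a) - ⟪x - a, e⟫_ℝ • e‖ ≤ δ}

open ProbabilityTheory in
theorem stdGaussian_map_inner {H : Type*} [NormedAddCommGroup H] [InnerProductSpace ℝ H]
    [FiniteDimensional ℝ H] [MeasurableSpace H] [BorelSpace H] (a : H) :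
    (stdGaussian H).map (fun ω => ⟪a, ω⟫_ℝ) = (gaussianReal 0 1).map (‖a‖ * ·) := by
  have h := IsGaussian.map_eq_gaussianReal (μ := stdGaussian H) (innerSL ℝ a)
  rw [integral_strongDual_stdGaussian, variance_dual_stdGaussian, innerSL_apply_norm] at h
  rw [gaussianReal_map_const_mul]
  rw [mul_zero, mul_one]
  refine h.trans (congrArg _ ?_)
  exact NNReal.eq (by simp)

open ProbabilityTheory in
theorem exists_gaussianReal_lower_bound :
    ∃ c : ℝ, 0 < c ∧ ∀ s : Set ℝ, MeasurableSet s → s ⊆ Set.Icc (-2) 2 →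
      ENNReal.ofReal c * volume s ≤ gaussianReal 0 1 s := by
  refine ⟨gaussianPDFReal 0 1 2, gaussianPDFReal_pos _ _ _ one_ne_zero, fun s hm hs => ?_⟩
  rw [gaussianReal_apply _ one_ne_zero, ← setLIntegral_const]
  refine setLIntegral_mono' hm fun x hx => ENNReal.ofReal_le_ofReal ?_
  rw [gaussianPDFReal_def]
  obtain ⟨h1, h2⟩ := hs hx
  have : x ^ 2 ≤ 2 ^ 2 := by nlinarith
  simp only [sub_zero, NNReal.coe_one, mul_one]
  gcongr

/-- Two unit vectors `u`, `v` are separated by a random Gaussian hyperplane with probability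
at least a dimension-free multiple of `‖u - v‖`. -/
theorem exists_gaussian_separation_bound :
    ∃ c : ℝ, 0 < c ∧ ∀ (κ : Type) [Fintype κ] (u v : EuclideanSpace ℝ κ), ‖u‖ = 1 → ‖v‖ = 1 →
      ENNReal.ofReal (c * ‖u - v‖) ≤
        ProbabilityTheory.stdGaussian (EuclideanSpace ℝ κ) {ω | ⟪u, ω⟫_ℝ * ⟪v, ω⟫_ℝ < 0} := by
  open ProbabilityTheory in
  obtain ⟨c, hc, hg⟩ := exists_gaussianReal_lower_bound
  refine ⟨c * c, by positivity, fun κ _ u v hu hv => ?_⟩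
  set P := stdGaussian (EuclideanSpace ℝ κ)
  set a := u - v with ha
  set b := u + v with hb
  rcases eq_or_ne ‖a‖ 0 with h0 | h0
  · simp [h0]
  have ha0 : 0 < ‖a‖ := lt_of_le_of_ne (norm_nonneg _) h0.symm
  have ha2 : ‖a‖ ≤ 2 := (norm_sub_le _ _).trans (by rw [hu, hv]; norm_num)
  have hb2 : ‖b‖ ≤ 2 := (norm_add_le _ _).trans (by rw [hu, hv]; norm_num)
  have hind : IndepFun (fun ω => ⟪a, ω⟫_ℝ) (fun ω => ⟪b, ω⟫_ℝ) P := by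
    refine HasGaussianLaw.indepFun_of_covariance_eq_zero ?_ ?_
    · exact IsGaussian.hasGaussianLaw_id.map ((innerSL ℝ a).prod (innerSL ℝ b))
    · rw [← covarianceBilin_apply_eq_cov IsGaussian.memLp_two_id, covarianceBilin_stdGaussian,
        innerSL_apply_apply, ha, hb, inner_sub_left,
        inner_add_right, inner_add_right, real_inner_self_eq_norm_sq, real_inner_self_eq_norm_sq,
        hu, hv, real_inner_comm]
      ring
  have hA : ENNReal.ofReal c ≤ P {ω | ‖a‖ ≤ |⟪a, ω⟫_ℝ|} := by
    have : P {ω | ‖a‖ ≤ |⟪a, ω⟫_ℝ|} = gaussianReal 0 1 {x | ‖a‖ ≤ |‖a‖ * x|} := by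
      have hm : MeasurableSet {y : ℝ | ‖a‖ ≤ |y|} := measurableSet_le (by fun_prop) (by fun_prop)
      have := congrArg (fun m => m {y : ℝ | ‖a‖ ≤ |y|}) (stdGaussian_map_inner a)
      rwa [Measure.map_apply (by fun_prop) hm, Measure.map_apply (by fun_prop) hm] at this
    rw [this]
    refine le_trans ?_ ((hg (Set.Icc 1 2) measurableSet_Icc ?_).trans (measure_mono ?_))
    · rw [Real.volume_Icc]; norm_num
    · exact Set.Icc_subset_Icc (by norm_num) le_rfl
    · intro x hx
      have h1 : 1 ≤ |x| := hx.1.trans (le_abs_self x)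
      simp only [Set.mem_ofPred_eq, abs_mul, abs_norm]
      nlinarith
  have hB : ENNReal.ofReal (c * ‖a‖) ≤ P {ω | |⟪b, ω⟫_ℝ| < ‖a‖} := by
    have : P {ω | |⟪b, ω⟫_ℝ| < ‖a‖} = gaussianReal 0 1 {x | |‖b‖ * x| < ‖a‖} := by
      have hm : MeasurableSet {y : ℝ | |y| < ‖a‖} := measurableSet_lt (by fun_prop) (by fun_prop)
      have := congrArg (fun m => m {y : ℝ | |y| < ‖a‖}) (stdGaussian_map_inner b)
      rwa [Measure.map_apply (by fun_prop) hm, Measure.map_apply (by fun_prop) hm] at this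
    rw [this]
    refine le_trans ?_ ((hg (Set.Ioo (-(‖a‖ / 2)) (‖a‖ / 2)) measurableSet_Ioo ?_).trans
      (measure_mono ?_))
    · rw [Real.volume_Ioo, ← ENNReal.ofReal_mul hc.le]
      apply le_of_eq; ring_nf
    · intro x hx
      constructor <;> linarith [hx.1, hx.2]
    · intro x hx
      have h1 : |x| < ‖a‖ / 2 := abs_lt.2 hx
      simp only [Set.mem_ofPred_eq, abs_mul, abs_norm]
      nlinarith [abs_nonneg x, norm_nonneg b]
  have key := hind.measure_inter_preimage_eq_mul {y : ℝ | ‖a‖ ≤ |y|} {y : ℝ | |y| < ‖a‖}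
    (measurableSet_le (by fun_prop) (by fun_prop)) (measurableSet_lt (by fun_prop) (by fun_prop))
  calc ENNReal.ofReal (c * c * ‖a‖) = ENNReal.ofReal c * ENNReal.ofReal (c * ‖a‖) := by
        rw [← ENNReal.ofReal_mul hc.le, mul_assoc]
    _ ≤ _ := mul_le_mul' hA hB
    _ = _ := key.symm
    _ ≤ _ := by
        refine measure_mono fun ω hω => ?_
        obtain ⟨h1, h2⟩ := hω
        simp only [Set.mem_preimage, Set.mem_ofPred_eq] at h1 h2 ⊢
        have h3 : ⟪b, ω⟫_ℝ ^ 2 < ⟪a, ω⟫_ℝ ^ 2 := sq_lt_sq.2 (h2.trans_le h1)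
        rw [ha, hb, inner_add_left, inner_sub_left] at h3
        nlinarith

theorem volume_sign_change_le (f : Polynomial ℝ) {h : ℝ} (hh : 0 < h) :
    volume {t : ℝ | f.eval t * f.eval (t + h) < 0} ≤ ENNReal.ofReal (f.natDegree * h) := by
  rcases eq_or_ne f 0 with rfl | hf
  · simp
  have hsub : {t : ℝ | f.eval t * f.eval (t + h) < 0} ⊆
      ⋃ r ∈ f.roots.toFinset, Set.Icc (r - h) r := by
    intro t ht
    have hc : ContinuousOn (fun x => f.eval x) (Set.uIcc t (t + h)) := f.continuous.continuousOn
    have h0 : (0 : ℝ) ∈ Set.uIcc (f.eval t) (f.eval (t + h)) := by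
      rcases mul_neg_iff.1 (show f.eval t * f.eval (t + h) < 0 from ht) with ⟨h1, h2⟩ | ⟨h1, h2⟩
      · exact Set.mem_uIcc.2 (Or.inr ⟨h2.le, h1.le⟩)
      · exact Set.mem_uIcc.2 (Or.inl ⟨h1.le, h2.le⟩)
    obtain ⟨r, hr, hr0⟩ := intermediate_value_uIcc hc h0
    rw [Set.uIcc_of_le (by linarith)] at hr
    refine Set.mem_biUnion (x := r) ?_ ⟨by linarith [hr.2], hr.1⟩
    simpa [hf] using hr0
  calc volume {t : ℝ | f.eval t * f.eval (t + h) < 0}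
      ≤ volume (⋃ r ∈ f.roots.toFinset, Set.Icc (r - h) r) := measure_mono hsub
    _ ≤ ∑ r ∈ f.roots.toFinset, volume (Set.Icc (r - h) r) := measure_biUnion_finset_le _ _
    _ = f.roots.toFinset.card * ENNReal.ofReal h := by simp
    _ ≤ f.natDegree * ENNReal.ofReal h := by
        gcongr
        exact_mod_cast (Multiset.toFinset_card_le _).trans (Polynomial.card_roots' f)
    _ = _ := by rw [ENNReal.ofReal_mul (by positivity), ENNReal.ofReal_natCast]

/-- A curve of unit vectors that is pointwise proportional to a polynomial curve of degree `N` has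
length at most a dimension-free multiple of `N`. -/
theorem exists_length_bound :
    ∃ C : ℝ, 0 < C ∧ ∀ (κ : Type) [Fintype κ] (N : ℕ) (p : κ → Polynomial ℝ) (ρ : ℝ → ℝ)
      (γ : ℝ → EuclideanSpace ℝ κ), (∀ i, (p i).natDegree ≤ N) → (∀ t, 0 < ρ t) →
      (∀ t i, γ t i = ρ t * (p i).eval t) → (∀ t, ‖γ t‖ = 1) → Differentiable ℝ γ →
      ∫⁻ t, ‖deriv γ t‖ₑ ≤ ENNReal.ofReal (C * N) := by
  obtain ⟨c, hc, hsep⟩ := exists_gaussian_separation_bound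
  refine ⟨c⁻¹, by positivity, fun κ _ N p ρ γ hdeg hρ hγ hn hd => ?_⟩
  set P := ProbabilityTheory.stdGaussian (EuclideanSpace ℝ κ)
  have hcont : Continuous γ := hd.continuous
  have step : ∀ h : ℝ, 0 < h → ∫⁻ t, ‖γ (t + h) - γ t‖ₑ ≤ ENNReal.ofReal (c⁻¹ * N * h) := by
    intro h hh
    have h1 : ∀ t, ENNReal.ofReal c * ‖γ (t + h) - γ t‖ₑ ≤
        P {ω | ⟪γ t, ω⟫_ℝ * ⟪γ (t + h), ω⟫_ℝ < 0} := by
      intro t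
      refine le_trans (le_of_eq ?_) (hsep κ (γ t) (γ (t + h)) (hn _) (hn _))
      rw [norm_sub_rev, ENNReal.ofReal_mul hc.le, ofReal_norm]
    have hms : MeasurableSet {q : ℝ × EuclideanSpace ℝ κ |
        ⟪γ q.1, q.2⟫_ℝ * ⟪γ (q.1 + h), q.2⟫_ℝ < 0} :=
      measurableSet_lt (Continuous.measurable (by fun_prop)) measurable_const
    have h2 : ∀ ω : EuclideanSpace ℝ κ,
        volume {t : ℝ | ⟪γ t, ω⟫_ℝ * ⟪γ (t + h), ω⟫_ℝ < 0} ≤ ENNReal.ofReal (N * h) := by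
      intro ω
      set f : Polynomial ℝ := ∑ i, Polynomial.C (ω i) * p i with hf
      have hin : ∀ t, ⟪γ t, ω⟫_ℝ = ρ t * f.eval t := by
        intro t
        simp only [PiLp.inner_apply, hγ, hf, Polynomial.eval_finsetSum, Polynomial.eval_mul,
          Polynomial.eval_C, Finset.mul_sum, RCLike.inner_apply, conj_trivial]
        exact Finset.sum_congr rfl fun i _ => by ring
      have hfN : f.natDegree ≤ N :=
        Polynomial.natDegree_sum_le_of_forall_le _ _ fun i _ =>
          (Polynomial.natDegree_C_mul_le _ _).trans (hdeg i)
      refine (measure_mono fun t ht => ?_).trans ((volume_sign_change_le f hh).trans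
        (ENNReal.ofReal_le_ofReal (by gcongr)))
      have ht' : ⟪γ t, ω⟫_ℝ * ⟪γ (t + h), ω⟫_ℝ < 0 := ht
      rw [hin, hin] at ht'
      show f.eval t * f.eval (t + h) < 0
      by_contra hcon
      push Not at hcon
      have := mul_nonneg (mul_pos (hρ t) (hρ (t + h))).le hcon
      nlinarith
    have h3 : ENNReal.ofReal c * ∫⁻ t, ‖γ (t + h) - γ t‖ₑ ≤ ENNReal.ofReal (N * h) := by
      rw [← lintegral_const_mul _ (Continuous.measurable (by fun_prop))]
      calc ∫⁻ t, ENNReal.ofReal c * ‖γ (t + h) - γ t‖ₑ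
          ≤ ∫⁻ t, P (Prod.mk t ⁻¹' {q : ℝ × EuclideanSpace ℝ κ |
              ⟪γ q.1, q.2⟫_ℝ * ⟪γ (q.1 + h), q.2⟫_ℝ < 0}) := lintegral_mono h1
        _ = ∫⁻ ω, volume ((fun t => (t, ω)) ⁻¹' {q : ℝ × EuclideanSpace ℝ κ |
              ⟪γ q.1, q.2⟫_ℝ * ⟪γ (q.1 + h), q.2⟫_ℝ < 0}) ∂P := by
            rw [← Measure.prod_apply hms, Measure.prod_apply_symm hms]
        _ ≤ ∫⁻ ω, ENNReal.ofReal (N * h) ∂P := lintegral_mono h2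
        _ = _ := by simp
    have hc' : ENNReal.ofReal c ≠ 0 := by simpa using hc
    rw [mul_comm, ← ENNReal.le_div_iff_mul_le (Or.inl hc') (Or.inl ENNReal.ofReal_ne_top),
      ← ENNReal.ofReal_div_of_pos hc] at h3
    refine h3.trans (le_of_eq (congrArg _ ?_))
    field_simp
  set ε : ℕ → ℝ := fun k => ((k : ℝ) + 1)⁻¹ with hε
  have hε0 : ∀ k, 0 < ε k := fun k => by positivity
  have hlim : ∀ t, Filter.Tendsto (fun k => ‖(ε k)⁻¹ • (γ (t + ε k) - γ t)‖ₑ) Filter.atTop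
      (nhds ‖deriv γ t‖ₑ) := by
    intro t
    refine (continuous_enorm.tendsto _).comp ?_
    have h1 := (hd t).hasDerivAt.tendsto_slope_zero
    refine h1.comp (tendsto_nhdsWithin_iff.2 ⟨?_, Filter.Eventually.of_forall
      fun k => (hε0 k).ne'⟩)
    simpa [hε] using tendsto_one_div_add_atTop_nhds_zero_nat (𝕜 := ℝ)
  calc ∫⁻ t, ‖deriv γ t‖ₑ
      = ∫⁻ t, Filter.liminf (fun k => ‖(ε k)⁻¹ • (γ (t + ε k) - γ t)‖ₑ) Filter.atTop :=
        lintegral_congr fun t => (hlim t).liminf_eq.symm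
    _ ≤ Filter.liminf (fun k => ∫⁻ t, ‖(ε k)⁻¹ • (γ (t + ε k) - γ t)‖ₑ) Filter.atTop :=
        lintegral_liminf_le fun k => Continuous.measurable (by fun_prop)
    _ ≤ Filter.liminf (fun k : ℕ => ENNReal.ofReal (c⁻¹ * N)) Filter.atTop := by
        refine Filter.liminf_le_liminf (Filter.Eventually.of_forall fun k => ?_)
        simp only [enorm_smul]
        rw [lintegral_const_mul _ (Continuous.measurable (by fun_prop))]
        have h1 : ‖(ε k)⁻¹‖ₑ = ENNReal.ofReal (ε k)⁻¹ :=
          Real.enorm_of_nonneg (inv_nonneg.2 (hε0 k).le)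
        rw [h1]
        refine (mul_le_mul_right (step (ε k) (hε0 k)) _).trans ?_
        rw [← ENNReal.ofReal_mul (inv_nonneg.2 (hε0 k).le)]
        refine ENNReal.ofReal_le_ofReal (le_of_eq ?_)
        field_simp [(hε0 k).ne']
    _ = _ := by simp

theorem exists_abs_det_le (H : Type*) [NormedAddCommGroup H] [InnerProductSpace ℝ H]
    [FiniteDimensional ℝ H] :
    ∃ C : ℝ, ∀ L : H →L[ℝ] H, |L.det| ≤ C * ‖L‖ ^ (Module.finrank ℝ H) := by
  obtain ⟨C, hC⟩ := (isCompact_closedBall (0 : H →L[ℝ] H) 1).exists_bound_of_continuousOn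
    (f := fun L : H →L[ℝ] H => L.det) ContinuousLinearMap.continuous_det.continuousOn
  refine ⟨C, fun L => ?_⟩
  rcases eq_or_ne ‖L‖ 0 with h0 | h0
  · rw [norm_eq_zero] at h0
    subst h0
    have h1 : (0 : H →L[ℝ] H).det = 0 ^ (Module.finrank ℝ H) := LinearMap.det_zero
    have h2 := hC 0 (by simp)
    rw [h1] at h2 ⊢
    rcases Nat.eq_zero_or_pos (Module.finrank ℝ H) with h | h
    · simpa [h] using h2
    · simp [h.ne']
  · have h1 : L = ‖L‖ • (‖L‖⁻¹ • L) := by rw [smul_smul, mul_inv_cancel₀ h0, one_smul]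
    have h2 : L.det = ‖L‖ ^ (Module.finrank ℝ H) * (‖L‖⁻¹ • L).det := by
      conv_lhs => rw [h1]
      exact LinearMap.det_smul _ _
    have h3 := hC (‖L‖⁻¹ • L) (by simp [norm_smul, h0])
    rw [h2, abs_mul, abs_of_nonneg (by positivity), mul_comm]
    gcongr
    exact h3

section BalancedMap

variable {X H : Type*} [MeasurableSpace X] [NormedAddCommGroup H] [InnerProductSpace ℝ H]
  [MeasurableSpace H] [BorelSpace H]

theorem exists_uniform_small_ball [FiniteDimensional ℝ H] (μ : Measure X) [IsFiniteMeasure μ] (φ : X → H)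
    (hφ : Measurable φ) {B : ℝ} (hB : ∀ᵐ x ∂μ, ‖φ x‖ ≤ B)
    (hnd : ∀ u : H, u ≠ 0 → μ {x | ⟪u, φ x⟫_ℝ = 0} = 0) {η : ℝ≥0∞} (hη : 0 < η) :
    ∃ δ : ℝ, 0 < δ ∧ ∀ u : H, ‖u‖ = 1 → μ {x | |⟪u, φ x⟫_ℝ| < δ} ≤ η := by
  have hm : ∀ (u : H) (δ : ℝ), MeasurableSet {x | |⟪u, φ x⟫_ℝ| < δ} := fun u δ =>
    measurableSet_lt (by fun_prop) measurable_const
  by_contra hcon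
  push Not at hcon
  choose u hu hlt using fun k : ℕ => hcon ((k : ℝ) + 1)⁻¹ (by positivity)
  obtain ⟨v, hv, s, hs, hlim⟩ := (isCompact_sphere (0 : H) 1).tendsto_subseq
    (x := u) (fun k => by simpa using hu k)
  have hv0 : v ≠ 0 := by
    rintro rfl
    simp at hv
  set A : ℕ → Set X := fun j => {x | |⟪v, φ x⟫_ℝ| < ((j : ℝ) + 1)⁻¹} with hA
  have hAlim : Filter.Tendsto (fun j => μ (A j)) Filter.atTop (nhds 0) := by
    have h := tendsto_measure_iInter_atTop (μ := μ) (s := A)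
      (fun j => (hm v _).nullMeasurableSet) ?_ ⟨0, measure_ne_top _ _⟩
    · have h0 : ⋂ j, A j = {x | ⟪v, φ x⟫_ℝ = 0} := ?_
      · rwa [h0, hnd v hv0] at h
      ext x
      simp only [hA, Set.mem_iInter, Set.mem_ofPred_eq]
      constructor
      · intro h
        have : |⟪v, φ x⟫_ℝ| ≤ 0 := by
          refine ge_of_tendsto' (tendsto_one_div_add_atTop_nhds_zero_nat (𝕜 := ℝ)) fun j => ?_
          rw [one_div]
          exact (h j).le
        exact abs_eq_zero.1 (le_antisymm this (abs_nonneg _))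
      · intro h j
        rw [h, abs_zero]
        positivity
    · intro i j hij x hx
      refine lt_of_lt_of_le (show |⟪v, φ x⟫_ℝ| < ((j : ℝ) + 1)⁻¹ from hx) ?_
      gcongr
  obtain ⟨j, hj⟩ := (hAlim.eventually (gt_mem_nhds hη)).exists
  have hev : ∀ᶠ k in Filter.atTop, ‖v - u (s k)‖ * B + ((s k : ℝ) + 1)⁻¹ < ((j : ℝ) + 1)⁻¹ := by
    have h1 : Filter.Tendsto (fun k => ‖v - u (s k)‖ * B + ((s k : ℝ) + 1)⁻¹) Filter.atTop
        (nhds (‖v - v‖ * B + 0)) := by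
      refine Filter.Tendsto.add ((tendsto_const_nhds.sub hlim).norm.mul_const _) ?_
      simpa [Function.comp_def] using
        (tendsto_one_div_add_atTop_nhds_zero_nat (𝕜 := ℝ)).comp hs.tendsto_atTop
    refine h1.eventually (gt_mem_nhds ?_)
    simp only [sub_self, norm_zero, zero_mul, zero_add]
    positivity
  obtain ⟨k, hk⟩ := hev.exists
  refine absurd (hlt (s k)) (not_lt.2 (le_trans (measure_mono_ae ?_) hj.le))
  filter_upwards [hB] with x hx hxk
  have hxk' : |⟪u (s k), φ x⟫_ℝ| < ((s k : ℝ) + 1)⁻¹ := hxk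
  show |⟪v, φ x⟫_ℝ| < ((j : ℝ) + 1)⁻¹
  have h1 : ⟪v, φ x⟫_ℝ = ⟪v - u (s k), φ x⟫_ℝ + ⟪u (s k), φ x⟫_ℝ := by
    rw [inner_sub_left]; ring
  calc |⟪v, φ x⟫_ℝ| ≤ |⟪v - u (s k), φ x⟫_ℝ| + |⟪u (s k), φ x⟫_ℝ| := by
        rw [h1]; exact abs_add_le _ _
    _ ≤ ‖v - u (s k)‖ * B + ((s k : ℝ) + 1)⁻¹ := by
        refine add_le_add ((abs_real_inner_le_norm _ _).trans ?_) hxk'.le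
        gcongr
    _ < _ := hk

theorem integrable_log_one_add (μ : Measure X) [IsFiniteMeasure μ] (φ : X → H)
    (hφ : Measurable φ) {B : ℝ} (hB : ∀ᵐ x ∂μ, ‖φ x‖ ≤ B) (L : H →L[ℝ] H) :
    Integrable (fun x => Real.log (1 + ‖L (φ x)‖ ^ 2)) μ := by
  refine Integrable.of_bound (Measurable.aestronglyMeasurable (by fun_prop))
    (Real.log (1 + (‖L‖ * B) ^ 2)) ?_
  filter_upwards [hB] with x hx
  have h1 : ‖L (φ x)‖ ≤ ‖L‖ * B := (L.le_opNorm _).trans (by gcongr)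
  rw [Real.norm_of_nonneg (Real.log_nonneg (by nlinarith [sq_nonneg ‖L (φ x)‖]))]
  gcongr

theorem continuous_integral_log_one_add (μ : Measure X) [IsFiniteMeasure μ] (φ : X → H)
    (hφ : Measurable φ) {B : ℝ} (hB : ∀ᵐ x ∂μ, ‖φ x‖ ≤ B) :
    Continuous fun L : H →L[ℝ] H => ∫ x, Real.log (1 + ‖L (φ x)‖ ^ 2) ∂μ := by
  rw [continuous_iff_continuousAt]
  intro L₀
  refine continuousAt_of_dominated (bound := fun _ => Real.log (1 + ((‖L₀‖ + 1) * B) ^ 2))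
    (Filter.Eventually.of_forall fun L => Measurable.aestronglyMeasurable (by fun_prop)) ?_
    (integrable_const _) (Filter.Eventually.of_forall fun x => ?_)
  · filter_upwards [Metric.ball_mem_nhds L₀ one_pos] with L hL
    filter_upwards [hB] with x hx
    have h0 : ‖L‖ ≤ ‖L₀‖ + 1 := by
      have h1 : ‖L - L₀‖ < 1 := by simpa [dist_eq_norm] using hL
      have h2 := norm_add_le (L - L₀) L₀
      rw [sub_add_cancel] at h2
      linarith
    have h1 : ‖L (φ x)‖ ≤ (‖L₀‖ + 1) * B := (L.le_opNorm _).trans (by gcongr)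
    rw [Real.norm_of_nonneg (Real.log_nonneg (by nlinarith [sq_nonneg ‖L (φ x)‖]))]
    gcongr
  · refine ContinuousAt.log (by fun_prop) (by positivity)

theorem integral_log_one_add_ge [FiniteDimensional ℝ H] (μ : Measure X) [IsFiniteMeasure μ] (φ : X → H)
    (hφ : Measurable φ) {B : ℝ} (hB : ∀ᵐ x ∂μ, ‖φ x‖ ≤ B) {η δ : ℝ} (hη : 0 < η) (hδ : 0 < δ)
    (hδη : ∀ u : H, ‖u‖ = 1 → μ {x | |⟪u, φ x⟫_ℝ| < δ} ≤ ENNReal.ofReal η)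
    (L : H →L[ℝ] H) (hL : 2 ≤ δ * ‖L‖) :
    2 * Real.log (δ * ‖L‖ / 2) * (μ.real Set.univ - η) ≤
      ∫ x, Real.log (1 + ‖L (φ x)‖ ^ 2) ∂μ := by
  have hL0 : 0 < ‖L‖ := by
    by_contra h
    have : ‖L‖ = 0 := le_antisymm (not_lt.1 h) (norm_nonneg _)
    rw [this] at hL
    norm_num at hL
  obtain ⟨w, hw, hw2⟩ := (ContinuousLinearMap.adjoint L).exists_lt_apply_of_lt_opNorm
    (r := ‖L‖ / 2) (by rw [LinearIsometryEquiv.norm_map]; linarith)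
  set z := ContinuousLinearMap.adjoint L w
  have hz0 : 0 < ‖z‖ := by linarith
  set u := ‖z‖⁻¹ • z with hu
  have hu1 : ‖u‖ = 1 := by simp [hu, norm_smul, hz0.ne']
  set S := {x | |⟪u, φ x⟫_ℝ| < δ}
  have hS : MeasurableSet S := measurableSet_lt (by fun_prop) measurable_const
  have hSη : μ.real S ≤ η := ENNReal.toReal_le_of_le_ofReal hη.le (hδη u hu1)
  have hlog : 0 ≤ 2 * Real.log (δ * ‖L‖ / 2) := by
    have := Real.log_nonneg (x := δ * ‖L‖ / 2) (by linarith)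
    linarith
  have hge : ∀ x, Sᶜ.indicator (fun _ => 2 * Real.log (δ * ‖L‖ / 2)) x ≤
      Real.log (1 + ‖L (φ x)‖ ^ 2) := by
    intro x
    by_cases hx : x ∈ S
    · rw [Set.indicator_of_notMem (by simpa using hx)]
      exact Real.log_nonneg (by nlinarith [sq_nonneg ‖L (φ x)‖])
    · rw [Set.indicator_of_mem hx]
      have h1 : δ ≤ |⟪u, φ x⟫_ℝ| := not_lt.1 hx
      have h2 : |⟪z, φ x⟫_ℝ| ≤ ‖L (φ x)‖ := by
        rw [ContinuousLinearMap.adjoint_inner_left]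
        exact (abs_real_inner_le_norm _ _).trans (by nlinarith [norm_nonneg (L (φ x))])
      have h3 : |⟪u, φ x⟫_ℝ| = ‖z‖⁻¹ * |⟪z, φ x⟫_ℝ| := by
        rw [hu, real_inner_smul_left, abs_mul, abs_of_pos (inv_pos.2 hz0)]
      have h4 : δ * ‖L‖ / 2 ≤ ‖L (φ x)‖ := by
        rw [h3, inv_mul_eq_div, le_div_iff₀ hz0] at h1
        nlinarith
      have h5 : 2 * Real.log (δ * ‖L‖ / 2) = Real.log ((δ * ‖L‖ / 2) ^ 2) := by
        rw [Real.log_pow]; norm_num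
      rw [h5]
      refine Real.log_le_log (by positivity) ?_
      nlinarith [norm_nonneg (L (φ x)), mul_pos hδ hL0]
  calc 2 * Real.log (δ * ‖L‖ / 2) * (μ.real Set.univ - η)
      ≤ 2 * Real.log (δ * ‖L‖ / 2) * μ.real Sᶜ := by
        rw [measureReal_compl hS]
        gcongr
    _ = ∫ x, Sᶜ.indicator (fun _ => 2 * Real.log (δ * ‖L‖ / 2)) x ∂μ := by
        rw [integral_indicator_const _ hS.compl, smul_eq_mul, mul_comm]
    _ ≤ _ := integral_mono ((integrable_const _).indicator hS.compl)
        (integrable_log_one_add μ φ hφ hB L) hge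

theorem exists_det_maximizer [FiniteDimensional ℝ H] (μ : Measure X) [IsFiniteMeasure μ]
    (φ : X → H) (hφ : Measurable φ) {B : ℝ} (hB : ∀ᵐ x ∂μ, ‖φ x‖ ≤ B)
    (hnd : ∀ u : H, u ≠ 0 → μ {x | ⟪u, φ x⟫_ℝ = 0} = 0) {κ η : ℝ} (hκ : 0 < κ) (hη : 0 < η)
    (hκη : (Module.finrank ℝ H : ℝ) < κ * (μ.real Set.univ - η)) :
    ∃ L : H →L[ℝ] H, L.det ≠ 0 ∧ ∀ L' : H →L[ℝ] H,
      |L'.det| * Real.exp (-(κ / 2) * ∫ x, Real.log (1 + ‖L' (φ x)‖ ^ 2) ∂μ) ≤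
      |L.det| * Real.exp (-(κ / 2) * ∫ x, Real.log (1 + ‖L (φ x)‖ ^ 2) ∂μ) := by
  obtain ⟨δ, hδ, hδη⟩ := exists_uniform_small_ball μ φ hφ hB hnd (ENNReal.ofReal_pos.2 hη)
  obtain ⟨C, hC⟩ := exists_abs_det_le H
  set m := Module.finrank ℝ H
  set F : (H →L[ℝ] H) → ℝ := fun L =>
    |L.det| * Real.exp (-(κ / 2) * ∫ x, Real.log (1 + ‖L (φ x)‖ ^ 2) ∂μ) with hF
  have hcont : Continuous F := by
    have h1 := continuous_integral_log_one_add μ φ hφ hB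
    have h2 : Continuous fun L : H →L[ℝ] H => L.det := ContinuousLinearMap.continuous_det
    fun_prop
  have h1pos : 0 < F 1 := by
    have h1 : (1 : H →L[ℝ] H).det = 1 := LinearMap.det_id
    simp only [hF, h1]
    positivity
  set r := κ * (μ.real Set.univ - η) - m with hr
  have hlim : Filter.Tendsto (fun L : H →L[ℝ] H => C * (2 / δ) ^ m * (δ * ‖L‖ / 2) ^ (-r))
      (Filter.cocompact _) (nhds (C * (2 / δ) ^ m * 0)) := by
    have h1 : Filter.Tendsto (fun L : H →L[ℝ] H => δ * ‖L‖ / 2) (Filter.cocompact _)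
        Filter.atTop :=
      ((tendsto_norm_cocompact_atTop (E := H →L[ℝ] H)).const_mul_atTop hδ).atTop_div_const two_pos
    exact ((tendsto_rpow_neg_atTop (y := r) (by linarith)).comp h1).const_mul _
  rw [mul_zero] at hlim
  have hlarge : ∀ᶠ L : H →L[ℝ] H in Filter.cocompact _, 2 ≤ δ * ‖L‖ :=
    ((tendsto_norm_cocompact_atTop (E := H →L[ℝ] H)).const_mul_atTop hδ).eventually_ge_atTop 2
  obtain ⟨L, hL⟩ := hcont.exists_forall_ge' (x₀ := 1) (by
    filter_upwards [hlim.eventually (gt_mem_nhds h1pos), hlarge] with L hL h2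
    refine le_trans ?_ hL.le
    have hI := integral_log_one_add_ge μ φ hφ hB hη hδ hδη L h2
    set y := δ * ‖L‖ / 2 with hy
    have hypos : 0 < y := by linarith
    have hexp : Real.exp (-(κ / 2) * ∫ x, Real.log (1 + ‖L (φ x)‖ ^ 2) ∂μ) ≤
        y ^ (-(κ * (μ.real Set.univ - η))) := by
      rw [Real.rpow_def_of_pos hypos]
      refine Real.exp_le_exp.2 ?_
      nlinarith
    have hLy : ‖L‖ = 2 / δ * y := by rw [hy]; field_simp
    calc F L ≤ C * ‖L‖ ^ m * y ^ (-(κ * (μ.real Set.univ - η))) :=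
          mul_le_mul (hC L) hexp (Real.exp_pos _).le ((abs_nonneg _).trans (hC L))
      _ = C * (2 / δ) ^ m * y ^ (-r) := by
          rw [hLy, mul_pow, ← Real.rpow_natCast y, hr, neg_sub, Real.rpow_sub hypos,
            Real.rpow_neg hypos.le]
          ring)
  refine ⟨L, fun h0 => ?_, hL⟩
  have := hL 1
  simp only [hF, h0, abs_zero, zero_mul] at this h1pos
  linarith

theorem integrable_inner_sq_div (μ : Measure X) [IsFiniteMeasure μ] (ψ : X → H)
    (hψ : Measurable ψ) (w : H) :
    Integrable (fun x => ⟪w, ψ x⟫_ℝ ^ 2 / (1 + ‖ψ x‖ ^ 2)) μ := by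
  refine Integrable.of_bound (Measurable.aestronglyMeasurable (by fun_prop)) (‖w‖ ^ 2)
    (Filter.Eventually.of_forall fun x => ?_)
  rw [Real.norm_of_nonneg (by positivity), div_le_iff₀ (by positivity)]
  have h1 := abs_real_inner_le_norm w (ψ x)
  calc ⟪w, ψ x⟫_ℝ ^ 2 = |⟪w, ψ x⟫_ℝ| ^ 2 := (sq_abs _).symm
    _ ≤ (‖w‖ * ‖ψ x‖) ^ 2 := by gcongr
    _ ≤ _ := by nlinarith [sq_nonneg ‖w‖]

theorem integral_inner_sq_div_of_isMax [FiniteDimensional ℝ H] (μ : Measure X)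
    [IsFiniteMeasure μ]
    (φ : X → H) (hφ : Measurable φ) {B : ℝ} (hB : ∀ᵐ x ∂μ, ‖φ x‖ ≤ B) {κ : ℝ} (hκ : 0 < κ)
    (L : H →L[ℝ] H) (hdet : L.det ≠ 0) (hmax : ∀ L' : H →L[ℝ] H,
      |L'.det| * Real.exp (-(κ / 2) * ∫ x, Real.log (1 + ‖L' (φ x)‖ ^ 2) ∂μ) ≤
      |L.det| * Real.exp (-(κ / 2) * ∫ x, Real.log (1 + ‖L (φ x)‖ ^ 2) ∂μ))
    (w : H) (hw : ‖w‖ = 1) :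
    κ * ∫ x, ⟪w, L (φ x)⟫_ℝ ^ 2 / (1 + ‖L (φ x)‖ ^ 2) ∂μ = 1 := by
  set J := ∫ x, ⟪w, L (φ x)⟫_ℝ ^ 2 / (1 + ‖L (φ x)‖ ^ 2) ∂μ with hJ
  have key : ∀ t : ℝ, -1 < t → Real.log (1 + t) ≤ κ / 2 * ((2 * t + t ^ 2) * J) := by
    intro t ht
    set T : H →L[ℝ] H := ContinuousLinearMap.id ℝ H + t • (innerSL ℝ w).smulRight w with hT
    have hTapp : ∀ y, T y = y + (t * ⟪w, y⟫_ℝ) • w := fun y => by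
      simp [hT, smul_smul]
    have hTdet : T.det = 1 + t := by
      have h1 : (T : H →ₗ[ℝ] H) =
          LinearMap.transvection (t • (innerSL ℝ w : H →L[ℝ] ℝ) : H →ₗ[ℝ] ℝ) w := by
        ext y
        simp [LinearMap.transvection, hTapp]
      have h2 : T.det = LinearMap.det (T : H →ₗ[ℝ] H) := rfl
      rw [h2, h1, LinearMap.transvection.det]
      simp [hw]
    have hTsq : ∀ y, ‖T y‖ ^ 2 = ‖y‖ ^ 2 + (2 * t + t ^ 2) * ⟪w, y⟫_ℝ ^ 2 := by
      intro y
      rw [hTapp, norm_add_sq_real, norm_smul, hw, real_inner_smul_right, real_inner_comm,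
        mul_one, Real.norm_eq_abs, sq_abs]
      ring
    have hmul : (T ∘L L).det = (1 + t) * L.det := by
      rw [← hTdet]
      exact LinearMap.det_comp _ _
    have hi1 := integrable_log_one_add μ φ hφ hB (T ∘L L)
    have hi2 := integrable_log_one_add μ φ hφ hB L
    have hi3 := integrable_inner_sq_div μ (fun x => L (φ x)) (by fun_prop) w
    have hle : ∫ x, Real.log (1 + ‖(T ∘L L) (φ x)‖ ^ 2) ∂μ ≤
        ∫ x, Real.log (1 + ‖L (φ x)‖ ^ 2) ∂μ + (2 * t + t ^ 2) * J := by
      rw [hJ, ← integral_const_mul, ← integral_add hi2 (hi3.const_mul _)]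
      refine integral_mono hi1 (hi2.add (hi3.const_mul _)) fun x => ?_
      show Real.log (1 + ‖T (L (φ x))‖ ^ 2) ≤ _
      have hpos : 0 < 1 + ‖L (φ x)‖ ^ 2 := by positivity
      have hpos' : 0 < 1 + ‖T (L (φ x))‖ ^ 2 := by positivity
      have h1 := Real.log_le_sub_one_of_pos (div_pos hpos' hpos)
      rw [Real.log_div hpos'.ne' hpos.ne'] at h1
      have h2 : (1 + ‖T (L (φ x))‖ ^ 2) / (1 + ‖L (φ x)‖ ^ 2) - 1 =
          (2 * t + t ^ 2) * (⟪w, L (φ x)⟫_ℝ ^ 2 / (1 + ‖L (φ x)‖ ^ 2)) := by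
        rw [hTsq]
        field_simp
        ring
      linarith
    have h1 := hmax (T ∘L L)
    have ht1 : 0 < 1 + t := by linarith
    rw [hmul, abs_mul, abs_of_pos ht1] at h1
    have hd : 0 < |L.det| := abs_pos.2 hdet
    have h2 := Real.log_le_log (by positivity) h1
    rw [Real.log_mul (by positivity) (Real.exp_pos _).ne', Real.log_mul ht1.ne' hd.ne',
      Real.log_mul hd.ne' (Real.exp_pos _).ne', Real.log_exp, Real.log_exp] at h2
    nlinarith
  have hmin : IsLocalMin (fun t : ℝ => κ / 2 * ((2 * t + t ^ 2) * J) - Real.log (1 + t)) 0 := by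
    filter_upwards [lt_mem_nhds (show (-1 : ℝ) < 0 by norm_num)] with t ht
    have := key t ht
    simp only [mul_zero, add_zero, Real.log_one]
    norm_num
    linarith
  have hder : HasDerivAt (fun t : ℝ => κ / 2 * ((2 * t + t ^ 2) * J) - Real.log (1 + t))
      (κ * J - 1) 0 := by
    have h1 : HasDerivAt (fun t : ℝ => 2 * t + t ^ 2) 2 0 := by
      have := ((hasDerivAt_id (0 : ℝ)).const_mul 2).add ((hasDerivAt_id (0 : ℝ)).pow 2)
      norm_num at this
      exact this
    have h2 : HasDerivAt (fun t : ℝ => Real.log (1 + t)) 1 0 := by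
      have := ((hasDerivAt_id (0 : ℝ)).const_add 1).log (by simp)
      norm_num at this
      exact this
    have h3 := ((h1.mul_const J).const_mul (κ / 2)).sub h2
    rwa [show κ / 2 * (2 * J) - 1 = κ * J - 1 by ring] at h3
  linarith [hmin.hasDerivAt_eq_zero hder]

theorem exists_balanced_map [FiniteDimensional ℝ H] (μ : Measure X) [IsFiniteMeasure μ]
    (φ : X → H) (hφ : Measurable φ) {B : ℝ} (hB : ∀ᵐ x ∂μ, ‖φ x‖ ≤ B)
    (hnd : ∀ u : H, u ≠ 0 → μ {x | ⟪u, φ x⟫_ℝ = 0} = 0)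
    (hμ : μ.real Set.univ ≤ Module.finrank ℝ H) :
    ∃ L : H →L[ℝ] H, ∀ a : H,
      ∫ x, (1 + ⟪a, L (φ x)⟫_ℝ) ^ 2 / (1 + ‖L (φ x)‖ ^ 2) ∂μ ≤ 2 * (1 + ‖a‖ ^ 2) := by
  set N := μ.real Set.univ with hN
  set m := Module.finrank ℝ H
  rcases lt_or_ge N 1 with h1 | h1
  · refine ⟨0, fun a => ?_⟩
    simp
    nlinarith [sq_nonneg ‖a‖]
  have hm : (1 : ℝ) ≤ m := h1.trans hμ
  obtain ⟨κ, hκ⟩ : ∃ κ : ℝ, κ = m / (N - 1 / 2) := ⟨_, rfl⟩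
  have hN2 : 0 < N - 1 / 2 := by linarith
  have hκ0 : 0 < κ := by rw [hκ]; positivity
  have hκN : κ * (N - 1 / 2) = m := by rw [hκ, div_mul_cancel₀ _ hN2.ne']
  obtain ⟨L, hdet, hmax⟩ := exists_det_maximizer μ φ hφ hB hnd hκ0 (η := 1 / 4) (by norm_num)
    (by nlinarith)
  refine ⟨L, fun a => ?_⟩
  have hunit := integral_inner_sq_div_of_isMax μ φ hφ hB hκ0 L hdet hmax
  have hint := integrable_inner_sq_div μ (fun x => L (φ x)) (by fun_prop)
  have hall : κ * ∫ x, ⟪a, L (φ x)⟫_ℝ ^ 2 / (1 + ‖L (φ x)‖ ^ 2) ∂μ = ‖a‖ ^ 2 := by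
    rcases eq_or_ne a 0 with rfl | ha
    · simp
    · have ha' : ‖a‖ ≠ 0 := by simpa using ha
      have h2 := hunit (‖a‖⁻¹ • a) (by simp [norm_smul, ha'])
      have h3 : ∀ x, ⟪‖a‖⁻¹ • a, L (φ x)⟫_ℝ ^ 2 / (1 + ‖L (φ x)‖ ^ 2) =
          (‖a‖ ^ 2)⁻¹ * (⟪a, L (φ x)⟫_ℝ ^ 2 / (1 + ‖L (φ x)‖ ^ 2)) := fun x => by
        rw [real_inner_smul_left]; ring
      simp_rw [h3] at h2
      rw [integral_const_mul] at h2
      field_simp at h2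
      exact h2
  have hsum : κ * ∫ x, ‖L (φ x)‖ ^ 2 / (1 + ‖L (φ x)‖ ^ 2) ∂μ = m := by
    let b := stdOrthonormalBasis ℝ H
    have h2 : ∀ x, ‖L (φ x)‖ ^ 2 / (1 + ‖L (φ x)‖ ^ 2) =
        ∑ i, ⟪b i, L (φ x)⟫_ℝ ^ 2 / (1 + ‖L (φ x)‖ ^ 2) := fun x => by
      rw [← Finset.sum_div, b.sum_sq_inner_right]
    simp_rw [h2]
    rw [integral_finsetSum _ fun i _ => hint (b i), Finset.mul_sum,
      Finset.sum_congr rfl fun i _ => hunit (b i) (b.norm_eq_one i)]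
    simp [m]
  have hintn : Integrable (fun x => ‖L (φ x)‖ ^ 2 / (1 + ‖L (φ x)‖ ^ 2)) μ := by
    refine Integrable.of_bound (Measurable.aestronglyMeasurable (by fun_prop)) 1
      (Filter.Eventually.of_forall fun x => ?_)
    rw [Real.norm_of_nonneg (by positivity), div_le_iff₀ (by positivity)]
    linarith
  have hmass : ∫ x, (1 - ‖L (φ x)‖ ^ 2 / (1 + ‖L (φ x)‖ ^ 2)) ∂μ = 1 / 2 := by
    rw [integral_sub (integrable_const _) hintn, integral_const, smul_eq_mul, mul_one]
    have : κ * ∫ x, ‖L (φ x)‖ ^ 2 / (1 + ‖L (φ x)‖ ^ 2) ∂μ = κ * (N - 1 / 2) := by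
      rw [hsum, hκN]
    have := mul_left_cancel₀ hκ0.ne' this
    linarith
  have hκ1 : 1 ≤ κ := by
    by_contra h
    nlinarith
  have hint1 : Integrable (fun x => 2 * (1 - ‖L (φ x)‖ ^ 2 / (1 + ‖L (φ x)‖ ^ 2))) μ :=
    ((integrable_const _).sub hintn).const_mul _
  calc ∫ x, (1 + ⟪a, L (φ x)⟫_ℝ) ^ 2 / (1 + ‖L (φ x)‖ ^ 2) ∂μ
      ≤ ∫ x, (2 * (1 - ‖L (φ x)‖ ^ 2 / (1 + ‖L (φ x)‖ ^ 2)) +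
          2 * (⟪a, L (φ x)⟫_ℝ ^ 2 / (1 + ‖L (φ x)‖ ^ 2))) ∂μ := by
        refine integral_mono_of_nonneg (Filter.Eventually.of_forall fun x => ?_)
          (hint1.add ((hint a).const_mul _))
          (Filter.Eventually.of_forall fun x => ?_)
        · show 0 ≤ (1 + ⟪a, L (φ x)⟫_ℝ) ^ 2 / (1 + ‖L (φ x)‖ ^ 2)
          positivity
        · have hpos : 0 < 1 + ‖L (φ x)‖ ^ 2 := by positivity
          have h2 : 2 * (1 - ‖L (φ x)‖ ^ 2 / (1 + ‖L (φ x)‖ ^ 2)) +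
              2 * (⟪a, L (φ x)⟫_ℝ ^ 2 / (1 + ‖L (φ x)‖ ^ 2)) =
              (2 + 2 * ⟪a, L (φ x)⟫_ℝ ^ 2) / (1 + ‖L (φ x)‖ ^ 2) := by
            field_simp
            ring
          show (1 + ⟪a, L (φ x)⟫_ℝ) ^ 2 / (1 + ‖L (φ x)‖ ^ 2) ≤ _
          refine le_trans ?_ h2.ge
          gcongr
          nlinarith [sq_nonneg (1 - ⟪a, L (φ x)⟫_ℝ)]
    _ = 1 + 2 * ∫ x, ⟪a, L (φ x)⟫_ℝ ^ 2 / (1 + ‖L (φ x)‖ ^ 2) ∂μ := by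
        rw [integral_add hint1 ((hint a).const_mul _),
          integral_const_mul, integral_const_mul, hmass]
        norm_num
    _ ≤ 2 * (1 + ‖a‖ ^ 2) := by
        have h0 : 0 ≤ ∫ x, ⟪a, L (φ x)⟫_ℝ ^ 2 / (1 + ‖L (φ x)‖ ^ 2) ∂μ :=
          integral_nonneg fun x => by positivity
        nlinarith
end BalancedMap

theorem MvPolynomial.volume_zeros_eq_zero (n : ℕ) (p : MvPolynomial (Fin n) ℝ) (hp : p ≠ 0) :
    volume {x : Fin n → ℝ | MvPolynomial.eval x p = 0} = 0 := by
  induction n with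
  | zero =>
    have h1 : {x : Fin 0 → ℝ | MvPolynomial.eval x p = 0} = ∅ := by
      ext x
      simp only [Set.mem_ofPred_eq, Set.mem_empty_iff_false, iff_false]
      rw [MvPolynomial.eq_C_of_isEmpty p] at hp ⊢
      simpa using hp
    rw [h1, measure_empty]
  | succ n ih =>
    set f := MvPolynomial.finSuccEquiv ℝ n p with hf
    have hf0 : f ≠ 0 := by simpa [hf] using hp
    have hq := ih f.leadingCoeff (by simpa using hf0)
    have hmeas : MeasurableSet {x : Fin (n + 1) → ℝ | MvPolynomial.eval x p = 0} :=
      (isClosed_singleton.preimage (MvPolynomial.continuous_eval p)).measurableSet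
    have hmp := (volume_preserving_piFinSuccAbove (fun _ : Fin (n + 1) => ℝ) 0).symm
    rw [← hmp.measure_preimage hmeas.nullMeasurableSet, Measure.volume_eq_prod,
      Measure.prod_apply_symm (hmp.measurable hmeas)]
    refine (lintegral_eq_zero_iff' (Measurable.aemeasurable ?_)).2 ?_
    · exact measurable_measure_prodMk_right (hmp.measurable hmeas)
    · have hae : ∀ᵐ s : Fin n → ℝ, MvPolynomial.eval s f.leadingCoeff ≠ 0 := by
        rw [ae_iff]
        simpa using hq
      filter_upwards [hae] with s hs
      have hmap : Polynomial.map (MvPolynomial.eval s) f ≠ 0 := by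
        intro h
        apply hs
        have := congrArg (fun g => Polynomial.coeff g f.natDegree) h
        simpa [Polynomial.coeff_map] using this
      refine Set.Finite.measure_zero (Set.Finite.subset
        (Polynomial.map (MvPolynomial.eval s) f).roots.toFinset.finite_toSet ?_) _
      intro y hy
      have hy' : MvPolynomial.eval (Fin.cons y s : Fin (n + 1) → ℝ) p = 0 := by
        have h2 : (MeasurableEquiv.piFinSuccAbove (fun _ : Fin (n + 1) => ℝ) 0).symm (y, s) =
            (Fin.cons y s : Fin (n + 1) → ℝ) := by
          simp [MeasurableEquiv.piFinSuccAbove, Fin.insertNthEquiv]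
        rw [← h2]
        exact hy
      rw [MvPolynomial.eval_eq_eval_mv_eval'] at hy'
      simpa [hmap, Polynomial.IsRoot] using hy'

/-- All monomials in `d` variables of degree less than `D` in each variable. -/
noncomputable def monomialMap (d D : ℕ) (x : EuclideanSpace ℝ (Fin d)) :
    EuclideanSpace ℝ (Fin d → Fin D) :=
  WithLp.toLp 2 fun a => ∏ i, x i ^ (a i : ℕ)

theorem contDiff_monomialMap (d D : ℕ) : ContDiff ℝ 1 (monomialMap d D) := by
  rw [contDiff_euclidean]
  intro a
  show ContDiff ℝ 1 fun x : EuclideanSpace ℝ (Fin d) => ∏ i, x i ^ (a i : ℕ)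
  exact contDiff_prod fun i _ => ContDiff.pow (by fun_prop) _

theorem volume_inner_monomialMap_eq_zero (d D : ℕ) (u : EuclideanSpace ℝ (Fin d → Fin D))
    (hu : u ≠ 0) : volume {x | ⟪u, monomialMap d D x⟫_ℝ = 0} = 0 := by
  set e : (Fin d → Fin D) → (Fin d →₀ ℕ) :=
    fun a => Finsupp.equivFunOnFinite.symm fun i => (a i : ℕ) with he
  have hinj : Function.Injective e := by
    intro a b hab
    funext i
    exact Fin.ext (by simpa [he] using DFunLike.congr_fun hab i)
  set p : MvPolynomial (Fin d) ℝ := ∑ a, MvPolynomial.monomial (e a) (u a) with hp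
  have hp0 : p ≠ 0 := by
    intro h
    refine hu ?_
    ext a
    have h1 := congrArg (MvPolynomial.coeff (e a)) h
    simpa [hp, MvPolynomial.coeff_sum, MvPolynomial.coeff_monomial, hinj.eq_iff] using h1
  have heval : ∀ x : EuclideanSpace ℝ (Fin d),
      MvPolynomial.eval (WithLp.ofLp x) p = ⟪u, monomialMap d D x⟫_ℝ := by
    intro x
    simp [hp, he, MvPolynomial.eval_monomial, monomialMap, PiLp.inner_apply, mul_comm,
      Finsupp.prod_fintype]
  have hmeas : MeasurableSet {x : Fin d → ℝ | MvPolynomial.eval x p = 0} :=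
    (isClosed_singleton.preimage (MvPolynomial.continuous_eval p)).measurableSet
  have h := (EuclideanSpace.volume_preserving_symm_measurableEquiv_toLp
    (Fin d)).measure_preimage hmeas.nullMeasurableSet
  rw [MvPolynomial.volume_zeros_eq_zero d p hp0] at h
  rw [← h]
  congr 1
  ext x
  show ⟪u, monomialMap d D x⟫_ℝ = 0 ↔ MvPolynomial.eval (WithLp.ofLp x) p = 0
  rw [heval]

theorem exists_polynomial_monomialMap_line (d D : ℕ) (x v : EuclideanSpace ℝ (Fin d))
    (a : Fin d → Fin D) :
    ∃ p : Polynomial ℝ, p.natDegree ≤ d * D ∧ ∀ t : ℝ, monomialMap d D (x + t • v) a = p.eval t := by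
  refine ⟨∏ i, (Polynomial.C (v i) * Polynomial.X + Polynomial.C (x i)) ^ (a i : ℕ), ?_,
    fun t => ?_⟩
  · refine (Polynomial.natDegree_prod_le _ _).trans ?_
    calc ∑ i, ((Polynomial.C (v i) * Polynomial.X + Polynomial.C (x i)) ^ (a i : ℕ)).natDegree
        ≤ ∑ _i : Fin d, D := by
          refine Finset.sum_le_sum fun i _ => Polynomial.natDegree_pow_le.trans ?_
          calc (a i : ℕ) * (Polynomial.C (v i) * Polynomial.X + Polynomial.C (x i)).natDegree
              ≤ (a i : ℕ) * 1 := by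
                gcongr
                exact Polynomial.natDegree_linear_le
            _ ≤ D := by
                rw [mul_one]
                exact (a i).2.le
      _ = d * D := by simp
  · rw [Polynomial.eval_prod]
    show ∏ i, (x + t • v) i ^ (a i : ℕ) = _
    refine Finset.prod_congr rfl fun i _ => ?_
    simp
    ring

/-- The inverse gnomonic projection onto the unit sphere. -/
noncomputable def sphereLift {ι : Type} [Fintype ι] (y : EuclideanSpace ℝ ι) :
    EuclideanSpace ℝ (Option ι) :=
  (√(1 + ‖y‖ ^ 2))⁻¹ • WithLp.toLp 2 fun o => o.elim 1 y

section SphereLift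

variable {ι : Type} [Fintype ι]

theorem inner_sphereLift (y z : EuclideanSpace ℝ ι) :
    ⟪sphereLift y, sphereLift z⟫_ℝ =
      (√(1 + ‖y‖ ^ 2))⁻¹ * ((√(1 + ‖z‖ ^ 2))⁻¹ * (1 + ⟪y, z⟫_ℝ)) := by
  rw [sphereLift, sphereLift, real_inner_smul_left, real_inner_smul_right]
  simp [PiLp.inner_apply, Fintype.sum_option]

theorem norm_sphereLift (y : EuclideanSpace ℝ ι) : ‖sphereLift y‖ = 1 := by
  have h : ‖sphereLift y‖ ^ 2 = 1 := by
    rw [← real_inner_self_eq_norm_sq, inner_sphereLift, real_inner_self_eq_norm_sq, ← mul_assoc,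
      ← mul_inv, Real.mul_self_sqrt (by positivity), inv_mul_cancel₀ (by positivity)]
  exact (pow_eq_one_iff_of_nonneg (norm_nonneg _) two_ne_zero).1 h

theorem contDiff_sphereLift : ContDiff ℝ 1 (sphereLift (ι := ι)) := by
  refine ContDiff.smul (ContDiff.inv (ContDiff.sqrt ?_ fun y => by positivity)
    fun y => by positivity) ?_
  · exact contDiff_const.add (contDiff_norm_sq ℝ)
  · rw [contDiff_euclidean]
    rintro (_ | i)
    · exact contDiff_const
    · show ContDiff ℝ 1 fun y : EuclideanSpace ℝ ι => y i
      fun_prop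

end SphereLift

theorem exists_directed_sphere_map : ∃ C : ℝ, 0 < C ∧ ∀ (d D : ℕ)
    (μ : Measure (EuclideanSpace ℝ (Fin d))) [IsFiniteMeasure μ], μ ≪ volume →
    ∀ R : ℝ, (∀ᵐ x ∂μ, ‖x‖ ≤ R) → μ Set.univ ≤ (D : ℝ≥0∞) ^ d →
    ∃ (κ : Type) (_ : Fintype κ) (γ : EuclideanSpace ℝ (Fin d) → EuclideanSpace ℝ κ),
      ContDiff ℝ 1 γ ∧ (∀ x, ‖γ x‖ = 1) ∧
      (∀ x, ∫⁻ y, ENNReal.ofReal (⟪γ x, γ y⟫_ℝ ^ 2) ∂μ ≤ 2) ∧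
      ∀ x v, ∫⁻ t : ℝ, ‖fderiv ℝ γ (x + t • v) v‖ₑ ≤ ENNReal.ofReal (C * (d * D)) := by
  obtain ⟨C, hC, hlen⟩ := exists_length_bound
  refine ⟨C, hC, fun d D μ _ hac R hR hμ => ?_⟩
  set φ := monomialMap d D with hφ
  have hφc : ContDiff ℝ 1 φ := contDiff_monomialMap d D
  obtain ⟨B, hB⟩ := (isCompact_closedBall (0 : EuclideanSpace ℝ (Fin d)) R).exists_bound_of_continuousOn
    hφc.continuous.continuousOn
  obtain ⟨L, hL⟩ := exists_balanced_map μ φ hφc.continuous.measurable (B := B)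
    (by
      filter_upwards [hR] with x hx
      exact hB x (by simpa using hx))
    (fun u hu => hac (volume_inner_monomialMap_eq_zero d D u hu))
    (by
      refine ENNReal.toReal_le_of_le_ofReal (by positivity) (hμ.trans (le_of_eq ?_))
      simp [ENNReal.ofReal_pow])
  set γ : EuclideanSpace ℝ (Fin d) → EuclideanSpace ℝ (Option (Fin d → Fin D)) :=
    fun x => sphereLift (L (φ x)) with hγ
  have hγc : ContDiff ℝ 1 γ := contDiff_sphereLift.comp (L.contDiff.comp hφc)
  have hγn : ∀ x, ‖γ x‖ = 1 := fun x => norm_sphereLift _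
  refine ⟨_, inferInstance, γ, hγc, hγn, fun x => ?_, fun x v => ?_⟩
  · rw [← ofReal_integral_eq_lintegral_ofReal]
    · refine (ENNReal.ofReal_le_ofReal (q := 2) ?_).trans (by simp)
      have h1 : ∀ y, ⟪γ x, γ y⟫_ℝ ^ 2 = (1 + ‖L (φ x)‖ ^ 2)⁻¹ *
          ((1 + ⟪L (φ x), L (φ y)⟫_ℝ) ^ 2 / (1 + ‖L (φ y)‖ ^ 2)) := by
        intro y
        rw [hγ, inner_sphereLift, mul_pow, mul_pow, inv_pow, inv_pow,
          Real.sq_sqrt (by positivity), Real.sq_sqrt (by positivity)]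
        ring
      simp_rw [h1]
      rw [integral_const_mul, inv_mul_le_iff₀ (by positivity), mul_comm]
      exact hL _
    · refine Integrable.of_bound (Continuous.aestronglyMeasurable (by fun_prop)) 1
        (Filter.Eventually.of_forall fun y => ?_)
      have h1 := abs_real_inner_le_norm (γ x) (γ y)
      rw [hγn, hγn, mul_one] at h1
      rw [Real.norm_eq_abs, abs_pow]
      exact pow_le_one₀ (abs_nonneg _) h1
    · exact Filter.Eventually.of_forall fun y => sq_nonneg _
  · choose p hpd hp using exists_polynomial_monomialMap_line d D x v
    set P : Option (Fin d → Fin D) → Polynomial ℝ := fun o => o.elim 1 fun i =>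
      ∑ b, Polynomial.C (L (EuclideanSpace.single b 1) i) * p b with hP
    have hdiff : ∀ t : ℝ, HasDerivAt (fun t : ℝ => γ (x + t • v)) (fderiv ℝ γ (x + t • v) v) t := by
      intro t
      have h1 : HasDerivAt (fun t : ℝ => x + t • v) v t := by
        simpa using ((hasDerivAt_id t).smul_const v).const_add x
      exact ((hγc.differentiable one_ne_zero) _).hasFDerivAt.comp_hasDerivAt t h1
    have h := hlen _ (d * D) P (fun t => (√(1 + ‖L (φ (x + t • v))‖ ^ 2))⁻¹)
      (fun t => γ (x + t • v)) ?_ (fun t => by positivity) ?_ (fun t => hγn _)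
      (fun t => (hdiff t).differentiableAt)
    · simp_rw [(hdiff _).deriv] at h
      exact_mod_cast h
    · rintro (_ | i)
      · simp [hP]
      · refine Polynomial.natDegree_sum_le_of_forall_le _ _ fun b _ => ?_
        exact (Polynomial.natDegree_C_mul_le _ _).trans (hpd b)
    · rintro t (_ | i)
      · simp [hP, hγ, sphereLift]
      · have h1 : ∀ y : EuclideanSpace ℝ (Fin d → Fin D),
            L y i = ∑ b, L (EuclideanSpace.single b 1) i * y b := by
          intro y
          have h2 : y = ∑ b, y b • EuclideanSpace.single b (1 : ℝ) := by
            ext j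
            simp [Pi.single_apply]
          conv_lhs => rw [h2]
          simp [mul_comm]
        show (√(1 + ‖L (φ (x + t • v))‖ ^ 2))⁻¹ * L (φ (x + t • v)) i = _
        rw [h1]
        simp [hP, Polynomial.eval_finsetSum, hφ, hp]

theorem enorm_sub_le_lintegral_fderiv {E G : Type*} [NormedAddCommGroup E] [NormedSpace ℝ E]
    [NormedAddCommGroup G] [NormedSpace ℝ G] [CompleteSpace G] {γ : E → G}
    (hγ : ContDiff ℝ 1 γ) (x w : E) :
    ‖γ (x + w) - γ x‖ₑ ≤ ∫⁻ τ in Set.Icc (0 : ℝ) 1, ‖fderiv ℝ γ (x + τ • w) w‖ₑ := by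
  have hdiff : ∀ t : ℝ, HasDerivAt (fun t : ℝ => γ (x + t • w)) (fderiv ℝ γ (x + t • w) w) t := by
    intro t
    have h1 : HasDerivAt (fun t : ℝ => x + t • w) w t := by
      simpa using ((hasDerivAt_id t).smul_const w).const_add x
    exact ((hγ.differentiable one_ne_zero) _).hasFDerivAt.comp_hasDerivAt t h1
  have hcont : Continuous fun t : ℝ => fderiv ℝ γ (x + t • w) w := by
    have := hγ.continuous_fderiv one_ne_zero
    fun_prop
  have h := intervalIntegral.integral_eq_sub_of_hasDerivAt (a := 0) (b := 1)
    (fun t _ => hdiff t) (hcont.intervalIntegrable _ _)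
  rw [one_smul, zero_smul, add_zero, intervalIntegral.integral_of_le zero_le_one] at h
  rw [← h]
  refine (enorm_integral_le_lintegral_enorm _).trans (lintegral_mono_set Set.Ioc_subset_Icc_self)

theorem lintegral_enorm_sub_le {d : ℕ} {G : Type*} [NormedAddCommGroup G]
    [NormedSpace ℝ G] [CompleteSpace G]
    {γ : EuclideanSpace ℝ (Fin d) → G} (hγ : ContDiff ℝ 1 γ) (z : EuclideanSpace ℝ (Fin d))
    (v : Fin d → EuclideanSpace ℝ (Fin d)) (r s : Fin d → ℝ) (hrs : ∀ j, |r j| ≤ s j)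
    (hw : ‖∑ j, r j • v j‖ ≤ 1 / 2) :
    ∫⁻ x in ball z (1 / 2), ‖γ (x + ∑ j, r j • v j) - γ x‖ₑ ≤
      ∑ j, ENNReal.ofReal (s j) * ∫⁻ x in ball z 1, ‖fderiv ℝ γ x (v j)‖ₑ := by
  set w := ∑ j, r j • v j with hwdef
  have hfc := hγ.continuous_fderiv one_ne_zero
  have hmeas : ∀ u, Measurable fun p : EuclideanSpace ℝ (Fin d) × ℝ =>
      ‖fderiv ℝ γ (p.1 + p.2 • w) u‖ₑ := fun u => by
    refine Continuous.measurable ?_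
    fun_prop
  calc ∫⁻ x in ball z (1 / 2), ‖γ (x + w) - γ x‖ₑ
      ≤ ∫⁻ x in ball z (1 / 2), ∫⁻ τ in Set.Icc (0 : ℝ) 1, ‖fderiv ℝ γ (x + τ • w) w‖ₑ :=
        lintegral_mono fun x => enorm_sub_le_lintegral_fderiv hγ x w
    _ = ∫⁻ τ in Set.Icc (0 : ℝ) 1, ∫⁻ x in ball z (1 / 2), ‖fderiv ℝ γ (x + τ • w) w‖ₑ :=
        lintegral_lintegral_swap (hmeas w).aemeasurable
    _ ≤ ∫⁻ τ in Set.Icc (0 : ℝ) 1, ∫⁻ x in ball z 1, ‖fderiv ℝ γ x w‖ₑ := by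
        refine setLIntegral_mono measurable_const fun τ hτ => ?_
        rw [← lintegral_indicator measurableSet_ball, ← lintegral_indicator measurableSet_ball,
          ← lintegral_add_right_eq_self ((ball z 1).indicator _) (τ • w)]
        refine lintegral_mono fun x => ?_
        by_cases hx : x ∈ ball z (1 / 2)
        · rw [Set.indicator_of_mem hx, Set.indicator_of_mem]
          rw [mem_ball, dist_eq_norm] at hx ⊢
          have h1 : ‖τ • w‖ ≤ 1 / 2 := by
            rw [norm_smul, Real.norm_of_nonneg hτ.1]
            nlinarith [hτ.2, hτ.1, norm_nonneg w]
          calc ‖x + τ • w - z‖ = ‖(x - z) + τ • w‖ := by congr 1; abel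
            _ ≤ ‖x - z‖ + ‖τ • w‖ := norm_add_le _ _
            _ < 1 := by linarith
        · rw [Set.indicator_of_notMem hx]
          exact zero_le
    _ = ∫⁻ x in ball z 1, ‖fderiv ℝ γ x w‖ₑ := by simp
    _ ≤ ∫⁻ x in ball z 1, ∑ j, ENNReal.ofReal (s j) * ‖fderiv ℝ γ x (v j)‖ₑ := by
        refine lintegral_mono fun x => ?_
        rw [hwdef, map_sum]
        refine (enorm_sum_le _ _).trans (Finset.sum_le_sum fun j _ => ?_)
        rw [map_smul, enorm_smul]
        gcongr
        rw [Real.enorm_eq_ofReal_abs]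
        exact ENNReal.ofReal_le_ofReal (hrs j)
    _ = _ := by
        rw [lintegral_finsetSum']
        · refine Finset.sum_congr rfl fun j _ => lintegral_const_mul _ ?_
          refine Continuous.measurable ?_
          fun_prop
        · intro j _
          refine Measurable.aemeasurable (Measurable.const_mul ?_ _)
          refine Continuous.measurable ?_
          fun_prop

theorem lintegral_comp_linear_combination {d : ℕ} (v : Fin d → EuclideanSpace ℝ (Fin d))
    (s : Fin d → ℝ) (hs : ∀ j, 0 < s j) {c : ℝ} (hc : 0 < c)
    (hv : c ≤ |Matrix.det (Matrix.of fun i j => v j i)|)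
    (f : EuclideanSpace ℝ (Fin d) → ℝ≥0∞) (hf : Measurable f) :
    ∫⁻ t : Fin d → ℝ, f (∑ j, (t j * s j) • v j) ≤
      ENNReal.ofReal ((c * ∏ j, s j)⁻¹) * ∫⁻ y, f y := by
  set A : Matrix (Fin d) (Fin d) ℝ := Matrix.of fun i j => s j * v j i with hA
  have hdet : A.det = (∏ j, s j) * Matrix.det (Matrix.of fun i j => v j i) :=
    Matrix.det_mul_row s (Matrix.of fun i j => v j i)
  have hsp : 0 < ∏ j, s j := Finset.prod_pos fun j _ => hs j
  have hdet0 : A.det ≠ 0 := by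
    rw [hdet]
    refine mul_ne_zero hsp.ne' fun h => ?_
    rw [h, abs_zero] at hv
    linarith
  have hmap := Real.map_matrix_volume_pi_eq_smul_volume_pi hdet0
  have hform : ∀ t : Fin d → ℝ, ∑ j, (t j * s j) • v j = WithLp.toLp 2 (Matrix.toLin' A t) := by
    intro t
    ext i
    simp [hA, Matrix.mulVec, dotProduct]
    exact Finset.sum_congr rfl fun j _ => by ring
  have hm : Measurable (Matrix.toLin' A) := (LinearMap.continuous_of_finiteDimensional _).measurable
  have hm2 : Measurable fun y : Fin d → ℝ => f (WithLp.toLp 2 y) :=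
    hf.comp (PiLp.volume_preserving_toLp (Fin d)).measurable
  simp_rw [hform]
  rw [← lintegral_map (f := fun y : Fin d → ℝ => f (WithLp.toLp 2 y)) hm2 hm, hmap,
    lintegral_smul_measure, (PiLp.volume_preserving_toLp (Fin d)).lintegral_comp hf, smul_eq_mul]
  gcongr
  rw [abs_inv, hdet, abs_mul, abs_of_pos hsp, mul_comm]
  gcongr

theorem exists_le_prod_directional_variation (d : ℕ) {c : ℝ} (hc : 0 < c) :
    ∃ C : ℝ, 0 < C ∧ ∀ (κ : Type) [Fintype κ]
      (γ : EuclideanSpace ℝ (Fin d) → EuclideanSpace ℝ κ)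
      (μ : Measure (EuclideanSpace ℝ (Fin d))) (z : EuclideanSpace ℝ (Fin d)) (M : ℝ≥0∞)
      (v : Fin d → EuclideanSpace ℝ (Fin d)),
      ContDiff ℝ 1 γ → (∀ x, ‖γ x‖ = 1) →
      (∀ x, ∫⁻ y, ENNReal.ofReal (⟪γ x, γ y⟫_ℝ ^ 2) ∂μ ≤ 2) →
      M • volume.restrict (ball z 1) ≤ μ → (∀ j, ‖v j‖ = 1) →
      c ≤ |Matrix.det (Matrix.of fun i j => v j i)| →
      M ≤ ENNReal.ofReal C * ∏ j, ((∫⁻ x in ball z 1, ‖fderiv ℝ γ x (v j)‖ₑ) + 1) := by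
  set β := volume.real (ball (0 : EuclideanSpace ℝ (Fin d)) (1 / 2)) with hβ
  have hβ0 : 0 < β := ENNReal.toReal_pos (measure_ball_pos _ _ (by norm_num)).ne'
    measure_ball_lt_top.ne
  obtain ⟨k, hk0, hk1, hk2⟩ : ∃ k : ℝ, 0 < k ∧ d * k ≤ 1 / 2 ∧ 2 * (d * k) ≤ β / 2 := by
    refine ⟨min (1 / 2) (β / 4) / (d + 1), by positivity, ?_, ?_⟩
    · have h1 : d * (min (1 / 2) (β / 4) / (d + 1)) ≤ min (1 / 2) (β / 4) := by
        rw [← mul_div_assoc, div_le_iff₀ (by positivity)]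
        nlinarith [show 0 < min (1 / 2) (β / 4) by positivity]
      exact h1.trans (min_le_left _ _)
    · have h1 : d * (min (1 / 2) (β / 4) / (d + 1)) ≤ min (1 / 2) (β / 4) := by
        rw [← mul_div_assoc, div_le_iff₀ (by positivity)]
        nlinarith [show 0 < min (1 / 2) (β / 4) by positivity]
      linarith [h1.trans (min_le_right _ _)]
  refine ⟨4 / (c * k ^ d), by positivity, fun κ _ γ μ z M v hγ hγn hμ hM hvn hv => ?_⟩
  set V : Fin d → ℝ≥0∞ := fun j => ∫⁻ x in ball z 1, ‖fderiv ℝ γ x (v j)‖ₑ with hV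
  by_cases hfin : ∀ j, V j ≠ ∞
  swap
  · push Not at hfin
    obtain ⟨j, hj⟩ := hfin
    have h1 : ∏ j, (V j + 1) = ∞ := by
      rw [← Finset.mul_prod_erase _ _ (Finset.mem_univ j), hj, top_add]
      exact ENNReal.top_mul (Finset.prod_ne_zero_iff.2 fun i _ => by simp)
    rw [h1, ENNReal.mul_top (by simp; positivity)]
    exact le_top
  set s : Fin d → ℝ := fun j => k / ((V j).toReal + 1) with hs
  have hs0 : ∀ j, 0 < s j := fun j => by positivity
  have hsk : ∀ j, s j ≤ k := fun j => div_le_self hk0.le (by simp)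
  have hsV : ∀ j, ENNReal.ofReal (s j) * V j ≤ ENNReal.ofReal k := fun j => by
    rw [← ENNReal.ofReal_toReal (hfin j), ← ENNReal.ofReal_mul (hs0 j).le]
    refine ENNReal.ofReal_le_ofReal ?_
    rw [hs, div_mul_eq_mul_div]
    exact (div_le_iff₀ (by positivity)).2 (by nlinarith [ENNReal.toReal_nonneg (a := V j)])
  set W : (Fin d → ℝ) → EuclideanSpace ℝ (Fin d) := fun t => ∑ j, (t j * s j) • v j with hW
  have hWc : Continuous W := by fun_prop
  set Q : Set (Fin d → ℝ) := Set.Icc 0 1 with hQ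
  have hQm : MeasurableSet Q := measurableSet_Icc
  have hQv : volume Q = 1 := by simp [hQ, Real.volume_Icc_pi]
  have hts : ∀ t ∈ Q, ∀ j, |t j * s j| ≤ s j := by
    intro t ht j
    rw [abs_mul, abs_of_nonneg (ht.1 j), abs_of_pos (hs0 j)]
    exact mul_le_of_le_one_left (hs0 j).le (ht.2 j)
  have hWn : ∀ t ∈ Q, ‖W t‖ ≤ 1 / 2 := by
    intro t ht
    calc ‖W t‖ ≤ ∑ _j : Fin d, k := by
          refine norm_sum_le_of_le _ fun j _ => ?_
          rw [norm_smul, hvn, mul_one]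
          exact (hts t ht j).trans (hsk j)
      _ ≤ 1 / 2 := by simpa using hk1
  have hvar : ∀ t ∈ Q, ∫⁻ x in ball z (1 / 2), ‖γ (x + W t) - γ x‖ₑ ≤ ENNReal.ofReal (d * k) := by
    intro t ht
    refine (lintegral_enorm_sub_le hγ z v (fun j => t j * s j) s (hts t ht) (hWn t ht)).trans ?_
    refine (Finset.sum_le_sum fun j _ => hsV j).trans ?_
    simp [ENNReal.ofReal_mul]
  have hinner : Measurable fun p : EuclideanSpace ℝ (Fin d) × (Fin d → ℝ) =>
      ENNReal.ofReal (⟪γ p.1, γ (p.1 + W p.2)⟫_ℝ ^ 2) := by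
    have := hγ.continuous
    refine ENNReal.measurable_ofReal.comp (Continuous.measurable ?_)
    fun_prop
  have hdiffm : Measurable fun p : EuclideanSpace ℝ (Fin d) × (Fin d → ℝ) =>
      ‖γ (p.1 + W p.2) - γ p.1‖ₑ := by
    have := hγ.continuous
    refine Continuous.measurable ?_
    fun_prop
  have hpt : ∀ x t, 1 ≤ ENNReal.ofReal (⟪γ x, γ (x + W t)⟫_ℝ ^ 2) +
      2 * ‖γ (x + W t) - γ x‖ₑ := by
    intro x t
    have h22 : (2 : ℝ≥0∞) * ‖γ (x + W t) - γ x‖ₑ =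
        ENNReal.ofReal 2 * ENNReal.ofReal ‖γ (x + W t) - γ x‖ := by
      rw [ofReal_norm, ENNReal.ofReal_ofNat]
    rw [h22, ← ENNReal.ofReal_mul (by norm_num), ← ENNReal.ofReal_add (by positivity) (by positivity),
      ← ENNReal.ofReal_one]
    refine ENNReal.ofReal_le_ofReal ?_
    have h1 := norm_sub_sq_real (γ (x + W t)) (γ x)
    rw [hγn, hγn, real_inner_comm] at h1
    have h2 := norm_sub_le (γ (x + W t)) (γ x)
    rw [hγn, hγn] at h2
    have h3 := abs_le.1 (abs_real_inner_le_norm (γ x) (γ (x + W t)))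
    rw [hγn, hγn] at h3
    nlinarith [norm_nonneg (γ (x + W t) - γ x)]
  have hBv : volume (ball z (1 / 2)) = ENNReal.ofReal β := by
    rw [hβ, Measure.real, ENNReal.ofReal_toReal measure_ball_lt_top.ne,
      Measure.addHaar_ball_center]
  have hlow : ENNReal.ofReal β ≤
      (∫⁻ x in ball z (1 / 2), ∫⁻ t in Q, ENNReal.ofReal (⟪γ x, γ (x + W t)⟫_ℝ ^ 2)) +
        ENNReal.ofReal (β / 2) := by
    calc ENNReal.ofReal β = ∫⁻ x in ball z (1 / 2), ∫⁻ t in Q, 1 := by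
          rw [setLIntegral_one, hQv, setLIntegral_one, hBv]
      _ ≤ ∫⁻ x in ball z (1 / 2), ∫⁻ t in Q, (ENNReal.ofReal (⟪γ x, γ (x + W t)⟫_ℝ ^ 2) +
          2 * ‖γ (x + W t) - γ x‖ₑ) := lintegral_mono fun x => lintegral_mono fun t => hpt x t
      _ = (∫⁻ x in ball z (1 / 2), ∫⁻ t in Q, ENNReal.ofReal (⟪γ x, γ (x + W t)⟫_ℝ ^ 2)) +
          2 * ∫⁻ t in Q, ∫⁻ x in ball z (1 / 2), ‖γ (x + W t) - γ x‖ₑ := by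
        rw [← lintegral_lintegral_swap (f := fun x t => ‖γ (x + W t) - γ x‖ₑ)
            hdiffm.aemeasurable, ← lintegral_const_mul _ hdiffm.lintegral_prod_right',
          ← lintegral_add_left hinner.lintegral_prod_right']
        refine lintegral_congr fun x => ?_
        have h1 := hinner.comp (measurable_prodMk_left (x := x))
        have h2 := hdiffm.comp (measurable_prodMk_left (x := x))
        exact (lintegral_add_left h1 _).trans (congrArg _ (lintegral_const_mul _ h2))
      _ ≤ _ := by
        gcongr
        calc 2 * ∫⁻ t in Q, ∫⁻ x in ball z (1 / 2), ‖γ (x + W t) - γ x‖ₑ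
            ≤ 2 * ∫⁻ t in Q, ENNReal.ofReal (d * k) := by
              gcongr 2 * ?_
              exact setLIntegral_mono measurable_const hvar
          _ = ENNReal.ofReal (2 * (d * k)) := by
              simp [hQv, ENNReal.ofReal_mul]
          _ ≤ _ := ENNReal.ofReal_le_ofReal hk2
  set Z := ENNReal.ofReal ((c * ∏ j, s j)⁻¹) with hZ
  have hup : ∀ x ∈ ball z (1 / 2),
      M * ∫⁻ t in Q, ENNReal.ofReal (⟪γ x, γ (x + W t)⟫_ℝ ^ 2) ≤ Z * 2 := by
    intro x hx
    set f : EuclideanSpace ℝ (Fin d) → ℝ≥0∞ :=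
      (ball z 1).indicator fun y => ENNReal.ofReal (⟪γ x, γ y⟫_ℝ ^ 2) with hf
    have hf0 : Measurable fun y => ENNReal.ofReal (⟪γ x, γ y⟫_ℝ ^ 2) := by
      have := hγ.continuous
      refine ENNReal.measurable_ofReal.comp (Continuous.measurable ?_)
      fun_prop
    have hfm : Measurable f := hf0.indicator measurableSet_ball
    have h1 : ∫⁻ t in Q, ENNReal.ofReal (⟪γ x, γ (x + W t)⟫_ℝ ^ 2) ≤ ∫⁻ t, f (x + W t) := by
      rw [← lintegral_indicator hQm]
      refine lintegral_mono fun t => ?_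
      by_cases ht : t ∈ Q
      · rw [Set.indicator_of_mem ht, hf, Set.indicator_of_mem]
        rw [mem_ball, dist_eq_norm] at hx ⊢
        calc ‖x + W t - z‖ = ‖(x - z) + W t‖ := by congr 1; abel
          _ ≤ ‖x - z‖ + ‖W t‖ := norm_add_le _ _
          _ < 1 := by linarith [hWn t ht]
      · rw [Set.indicator_of_notMem ht]
        exact zero_le
    have h2 := lintegral_comp_linear_combination v s hs0 hc hv (fun y => f (x + y))
      (hfm.comp (measurable_const_add x))
    rw [lintegral_add_left_eq_self] at h2
    calc M * ∫⁻ t in Q, ENNReal.ofReal (⟪γ x, γ (x + W t)⟫_ℝ ^ 2)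
        ≤ M * (Z * ∫⁻ y, f y) := by gcongr; exact h1.trans h2
      _ = Z * ∫⁻ y, ENNReal.ofReal (⟪γ x, γ y⟫_ℝ ^ 2) ∂(M • volume.restrict (ball z 1)) := by
          rw [lintegral_smul_measure, hf, lintegral_indicator measurableSet_ball, smul_eq_mul]
          ring
      _ ≤ Z * ∫⁻ y, ENNReal.ofReal (⟪γ x, γ y⟫_ℝ ^ 2) ∂μ := by
          gcongr
      _ ≤ Z * 2 := by
          gcongr
          exact hμ x
  have hhalf : ENNReal.ofReal (β / 2) ≤
      ∫⁻ x in ball z (1 / 2), ∫⁻ t in Q, ENNReal.ofReal (⟪γ x, γ (x + W t)⟫_ℝ ^ 2) := by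
    have h1 : ENNReal.ofReal β = ENNReal.ofReal (β / 2) + ENNReal.ofReal (β / 2) := by
      rw [← ENNReal.ofReal_add (by positivity) (by positivity)]
      congr 1
      ring
    rw [h1] at hlow
    exact (ENNReal.add_le_add_iff_right ENNReal.ofReal_ne_top).1 hlow
  have hmain : M * ENNReal.ofReal (β / 2) ≤ Z * 2 * ENNReal.ofReal β := by
    calc M * ENNReal.ofReal (β / 2) ≤ M * ∫⁻ x in ball z (1 / 2),
          ∫⁻ t in Q, ENNReal.ofReal (⟪γ x, γ (x + W t)⟫_ℝ ^ 2) := by gcongr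
      _ = ∫⁻ x in ball z (1 / 2), M *
          ∫⁻ t in Q, ENNReal.ofReal (⟪γ x, γ (x + W t)⟫_ℝ ^ 2) :=
        (lintegral_const_mul _ hinner.lintegral_prod_right').symm
      _ ≤ ∫⁻ _x in ball z (1 / 2), Z * 2 := setLIntegral_mono measurable_const hup
      _ = Z * 2 * ENNReal.ofReal β := by rw [setLIntegral_const, hBv]
  have hM4 : M ≤ Z * 4 := by
    have h1 : Z * 2 * ENNReal.ofReal β = Z * 4 * ENNReal.ofReal (β / 2) := by
      rw [show β = 2 * (β / 2) by ring, ENNReal.ofReal_mul (by norm_num)]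
      rw [show (4 : ℝ≥0∞) = 2 * 2 by norm_num]
      simp
      ring
    rw [h1] at hmain
    exact (ENNReal.mul_le_mul_iff_left (by simp; positivity) ENNReal.ofReal_ne_top).1 hmain
  refine hM4.trans (le_of_eq ?_)
  have hprod : ∏ j, (V j + 1) = ENNReal.ofReal (∏ j, ((V j).toReal + 1)) := by
    rw [ENNReal.ofReal_prod_of_nonneg fun j _ => by positivity]
    refine Finset.prod_congr rfl fun j _ => ?_
    rw [ENNReal.ofReal_add ENNReal.toReal_nonneg zero_le_one, ENNReal.ofReal_toReal (hfin j),
      ENNReal.ofReal_one]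
  have hsprod : ∏ j, s j = k ^ d / ∏ j, ((V j).toReal + 1) := by
    rw [hs, Finset.prod_div_distrib]
    simp
  have hpos : 0 < ∏ j, ((V j).toReal + 1) := Finset.prod_pos fun j _ => by positivity
  rw [hprod, ← ENNReal.ofReal_mul (by positivity), hZ, hsprod,
    show (4 : ℝ≥0∞) = ENNReal.ofReal 4 by simp, ← ENNReal.ofReal_mul (by positivity)]
  congr 1
  field_simp

/-- A radially decreasing integrable weight on `ℝ^d` that is comparable at points at distance
at most `1`. -/
noncomputable def decayWeight {d : ℕ} (x : EuclideanSpace ℝ (Fin d)) : ℝ≥0∞ :=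
  ENNReal.ofReal ((1 + ‖x‖) ^ (-((d : ℝ) + 1)))

/-- A smoothed version of the characteristic function of a unit tube. -/
noncomputable def tubeWeight {d : ℕ} (a e x : EuclideanSpace ℝ (Fin d)) : ℝ≥0∞ :=
  ∫⁻ t : ℝ, decayWeight (x - a - t • e)

/-- Integrable truncations of the constant function `1`. -/
noncomputable def cutoffWeight {d : ℕ} (k : ℕ) (x : EuclideanSpace ℝ (Fin d)) : ℝ≥0∞ :=
  min 1 (k * decayWeight x)

section Weights

variable {d : ℕ}

theorem measurable_decayWeight : Measurable (decayWeight (d := d)) := by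
  unfold decayWeight
  fun_prop

theorem decayWeight_pos (x : EuclideanSpace ℝ (Fin d)) : 0 < decayWeight x :=
  ENNReal.ofReal_pos.2 (by positivity)

theorem decayWeight_le (x z : EuclideanSpace ℝ (Fin d)) (h : ‖x - z‖ ≤ 1) :
    decayWeight z ≤ 2 ^ (d + 1) * decayWeight x := by
  have h2 : (2 : ℝ≥0∞) ^ (d + 1) = ENNReal.ofReal (2 ^ ((d : ℝ) + 1)) := by
    rw [← ENNReal.ofReal_ofNat, ← ENNReal.ofReal_pow (by norm_num)]
    congr 1
    exact_mod_cast (Real.rpow_natCast 2 (d + 1)).symm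
  rw [h2, decayWeight, decayWeight, ← ENNReal.ofReal_mul (by positivity)]
  refine ENNReal.ofReal_le_ofReal ?_
  rw [Real.rpow_neg (by positivity), Real.rpow_neg (by positivity), ← div_eq_mul_inv,
    inv_le_iff_one_le_mul₀ (by positivity), div_mul_eq_mul_div, one_le_div (by positivity),
    ← Real.mul_rpow (by norm_num) (by positivity)]
  refine Real.rpow_le_rpow (by positivity) ?_ (by positivity)
  have h3 : ‖x‖ ≤ ‖x - z‖ + ‖z‖ := by simpa using norm_add_le (x - z) z
  linarith [norm_nonneg z]

theorem lintegral_decayWeight_lt_top :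
    ∫⁻ x : EuclideanSpace ℝ (Fin d), decayWeight x < ∞ := by
  refine finite_integral_one_add_norm ?_
  simp

theorem measurable_tubeWeight (a e : EuclideanSpace ℝ (Fin d)) : Measurable (tubeWeight a e) := by
  have h : Measurable fun p : EuclideanSpace ℝ (Fin d) × ℝ => decayWeight (p.1 - a - p.2 • e) :=
    measurable_decayWeight.comp (by fun_prop)
  exact h.lintegral_prod_right'

theorem tubeWeight_le (a e x z : EuclideanSpace ℝ (Fin d)) (h : ‖x - z‖ ≤ 1) :
    tubeWeight a e z ≤ 2 ^ (d + 1) * tubeWeight a e x := by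
  have hm : Measurable fun t : ℝ => decayWeight (x - a - t • e) :=
    measurable_decayWeight.comp (by fun_prop)
  rw [tubeWeight, tubeWeight, ← lintegral_const_mul _ hm]
  refine lintegral_mono fun t => decayWeight_le _ _ ?_
  have h1 : x - a - t • e - (z - a - t • e) = x - z := by abel
  rwa [h1]

theorem infTube_indicator_le (a e x : EuclideanSpace ℝ (Fin d)) (he : ‖e‖ = 1) :
    (infTube 1 a e).indicator (fun _ => (1 : ℝ≥0∞)) x ≤ 3 ^ (d + 1) * tubeWeight a e x := by
  by_cases hx : x ∈ infTube 1 a e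
  swap
  · rw [Set.indicator_of_notMem hx]
    exact zero_le
  rw [Set.indicator_of_mem hx]
  replace hx : ‖(x - a) - ⟪x - a, e⟫_ℝ • e‖ ≤ 1 := hx
  set t₀ := ⟪x - a, e⟫_ℝ
  have hlow : ∀ t ∈ Set.Icc t₀ (t₀ + 1), (3 ^ (d + 1))⁻¹ ≤ decayWeight (x - a - t • e) := by
    intro t ht
    have h1 : ‖x - a - t • e‖ ≤ 2 := by
      have h2 : x - a - t • e = (x - a - t₀ • e) + (t₀ - t) • e := by
        rw [sub_smul]; abel
      rw [h2]
      refine (norm_add_le _ _).trans ?_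
      have h3 : |t₀ - t| ≤ 1 := abs_le.2 ⟨by linarith [ht.2], by linarith [ht.1]⟩
      rw [norm_smul, he, mul_one, Real.norm_eq_abs]
      linarith
    have h4 : ((3 : ℝ≥0∞) ^ (d + 1))⁻¹ = ENNReal.ofReal (3 ^ (-((d : ℝ) + 1))) := by
      rw [Real.rpow_neg (by norm_num), ENNReal.ofReal_inv_of_pos (by positivity),
        ← ENNReal.ofReal_ofNat, ← ENNReal.ofReal_pow (by norm_num)]
      congr 2
      exact_mod_cast (Real.rpow_natCast 3 (d + 1)).symm
    rw [h4]
    refine ENNReal.ofReal_le_ofReal ?_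
    exact Real.rpow_le_rpow_of_nonpos (by positivity) (by linarith) (by linarith)
  have h5 : ((3 : ℝ≥0∞) ^ (d + 1))⁻¹ ≤ tubeWeight a e x := by
    calc ((3 : ℝ≥0∞) ^ (d + 1))⁻¹ = ∫⁻ t in Set.Icc t₀ (t₀ + 1), (3 ^ (d + 1))⁻¹ := by
          rw [setLIntegral_const]
          simp
      _ ≤ ∫⁻ t in Set.Icc t₀ (t₀ + 1), decayWeight (x - a - t • e) :=
          setLIntegral_mono (measurable_decayWeight.comp (by fun_prop)) hlow
      _ ≤ tubeWeight a e x := setLIntegral_le_lintegral _ _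
  calc (1 : ℝ≥0∞) = 3 ^ (d + 1) * (3 ^ (d + 1))⁻¹ :=
        (ENNReal.mul_inv_cancel (by simp) (by simp)).symm
    _ ≤ _ := by gcongr

theorem exists_tubeWeight_le (hd : 1 ≤ d) :
    ∃ K : ℝ≥0∞, K ≠ ∞ ∧ ∀ a e x : EuclideanSpace ℝ (Fin d), ‖e‖ = 1 → tubeWeight a e x ≤ K := by
  refine ⟨∫⁻ t : ℝ, ENNReal.ofReal ((1 + ‖t‖) ^ (-((d : ℝ) + 1))),
    (finite_integral_one_add_norm (μ := volume) (E := ℝ) ?_).ne, fun a e x he => ?_⟩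
  · have : (1 : ℝ) ≤ d := by exact_mod_cast hd
    simp
    linarith
  · rw [← lintegral_sub_left_eq_self _ ⟪e, x - a⟫_ℝ]
    refine lintegral_mono fun t => ENNReal.ofReal_le_ofReal ?_
    refine Real.rpow_le_rpow_of_nonpos (by positivity) ?_ (by linarith)
    have h1 := abs_real_inner_le_norm e (x - a - t • e)
    rw [he, one_mul, inner_sub_right, real_inner_smul_right, real_inner_self_eq_norm_sq, he] at h1
    norm_num at h1
    rw [Real.norm_eq_abs]
    linarith

theorem lintegral_tubeWeight_mul_le (a e : EuclideanSpace ℝ (Fin d))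
    (σ : EuclideanSpace ℝ (Fin d) → ℝ≥0∞) (hσ : Measurable σ) (Λ : ℝ≥0∞)
    (hΛ : ∀ x, ∫⁻ t : ℝ, σ (x + t • e) ≤ Λ) :
    ∫⁻ x, tubeWeight a e x * σ x ≤ (∫⁻ x : EuclideanSpace ℝ (Fin d), decayWeight x) * Λ := by
  have hh := measurable_decayWeight (d := d)
  have hm1 : ∀ t : ℝ, Measurable fun x => decayWeight (x - a - t • e) := fun t =>
    hh.comp (by fun_prop)
  calc ∫⁻ x, tubeWeight a e x * σ x
      = ∫⁻ x, ∫⁻ t : ℝ, decayWeight (x - a - t • e) * σ x := by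
        refine lintegral_congr fun x => ?_
        exact (lintegral_mul_const _ (hh.comp (by fun_prop))).symm
    _ = ∫⁻ t : ℝ, ∫⁻ x, decayWeight (x - a - t • e) * σ x := by
        refine lintegral_lintegral_swap (Measurable.aemeasurable ?_)
        exact (hh.comp (by fun_prop : Measurable fun p : EuclideanSpace ℝ (Fin d) × ℝ =>
          p.1 - a - p.2 • e)).mul (hσ.comp measurable_fst)
    _ = ∫⁻ t : ℝ, ∫⁻ x, decayWeight x * σ (x + a + t • e) := by
        refine lintegral_congr fun t => ?_
        rw [← lintegral_add_right_eq_self _ (a + t • e)]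
        refine lintegral_congr fun x => ?_
        rw [← add_assoc, add_sub_right_comm, add_sub_cancel_right, add_sub_cancel_right]
    _ = ∫⁻ x, ∫⁻ t : ℝ, decayWeight x * σ (x + a + t • e) := by
        refine (lintegral_lintegral_swap (Measurable.aemeasurable ?_)).symm
        exact (hh.comp measurable_fst).mul (hσ.comp
          (by fun_prop : Measurable fun p : EuclideanSpace ℝ (Fin d) × ℝ => p.1 + a + p.2 • e))
    _ ≤ ∫⁻ x, decayWeight x * Λ := by
        refine lintegral_mono fun x => ?_
        have hm : Measurable fun t : ℝ => σ (x + a + t • e) := hσ.comp (by fun_prop)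
        rw [lintegral_const_mul _ hm]
        gcongr
        exact hΛ _
    _ = _ := lintegral_mul_const _ hh

theorem measurable_cutoffWeight (k : ℕ) : Measurable (cutoffWeight (d := d) k) :=
  measurable_const.min (measurable_decayWeight.const_mul _)

theorem cutoffWeight_le (k : ℕ) (x z : EuclideanSpace ℝ (Fin d)) (h : ‖x - z‖ ≤ 1) :
    cutoffWeight k z ≤ 2 ^ (d + 1) * cutoffWeight k x := by
  unfold cutoffWeight
  rw [mul_min]
  refine min_le_min ?_ ?_
  · rw [mul_one]
    exact one_le_pow₀ (by norm_num)
  · rw [mul_left_comm]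
    gcongr
    exact decayWeight_le x z h

theorem lintegral_cutoffWeight_lt_top (k : ℕ) :
    ∫⁻ x : EuclideanSpace ℝ (Fin d), cutoffWeight k x < ∞ := by
  refine (lintegral_mono fun x => min_le_right _ _).trans_lt ?_
  rw [lintegral_const_mul _ measurable_decayWeight]
  exact ENNReal.mul_lt_top (by simp) lintegral_decayWeight_lt_top

theorem monotone_cutoffWeight (x : EuclideanSpace ℝ (Fin d)) :
    Monotone fun k => cutoffWeight k x := by
  intro k l hkl
  refine min_le_min le_rfl ?_
  gcongr

theorem iSup_cutoffWeight (x : EuclideanSpace ℝ (Fin d)) : ⨆ k, cutoffWeight k x = 1 := by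
  refine le_antisymm (iSup_le fun k => min_le_left _ _) ?_
  obtain ⟨k, hk⟩ := ENNReal.exists_nat_mul_gt (decayWeight_pos x).ne' ENNReal.one_ne_top
  exact (le_min le_rfl hk.le).trans (le_iSup (fun k => cutoffWeight k x) k)

end Weights

theorem mul_prod_sum_le {ι α : Type*} [Fintype ι] [DecidableEq ι] (s : ι → Finset α)
    (w b : α → ℝ≥0∞) (M C : ℝ≥0∞)
    (h : ∀ T : ι → α, (∀ j, T j ∈ s j) → M ≤ C * ∏ j, b (T j)) :
    M * ∏ j, ∑ T ∈ s j, w T ≤ C * ∏ j, ∑ T ∈ s j, w T * b T := by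
  rw [Finset.prod_univ_sum, Finset.prod_univ_sum, Finset.mul_sum, Finset.mul_sum]
  refine Finset.sum_le_sum fun T hT => ?_
  rw [Finset.prod_mul_distrib, mul_left_comm, mul_comm M]
  gcongr
  exact h T (Fintype.mem_piFinset.1 hT)

theorem lintegral_mul_lintegral_ball_le {d : ℕ} (w σ : EuclideanSpace ℝ (Fin d) → ℝ≥0∞)
    (hw : Measurable w) (hσ : Measurable σ) (A : ℝ≥0∞)
    (hA : ∀ x z, ‖x - z‖ ≤ 1 → w z ≤ A * w x) :
    ∫⁻ z, w z * ∫⁻ x in ball z 1, σ x ≤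
      A * volume (ball (0 : EuclideanSpace ℝ (Fin d)) 1) * ∫⁻ x, w x * σ x := by
  have hD : MeasurableSet {p : EuclideanSpace ℝ (Fin d) × EuclideanSpace ℝ (Fin d) |
      dist p.2 p.1 < 1} := measurableSet_lt (by fun_prop) measurable_const
  have hm : Measurable fun p : EuclideanSpace ℝ (Fin d) × EuclideanSpace ℝ (Fin d) =>
      w p.1 * (ball p.1 1).indicator σ p.2 :=
    (hw.comp measurable_fst).mul ((hσ.comp measurable_snd).indicator hD)
  calc ∫⁻ z, w z * ∫⁻ x in ball z 1, σ x
      = ∫⁻ z, ∫⁻ x, w z * (ball z 1).indicator σ x := by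
        refine lintegral_congr fun z => ?_
        rw [lintegral_const_mul _ (hσ.indicator measurableSet_ball),
          lintegral_indicator measurableSet_ball]
    _ = ∫⁻ x, ∫⁻ z, w z * (ball z 1).indicator σ x := lintegral_lintegral_swap hm.aemeasurable
    _ ≤ ∫⁻ x, ∫⁻ z in ball x 1, A * w x * σ x := by
        refine lintegral_mono fun x => ?_
        rw [← lintegral_indicator measurableSet_ball]
        refine lintegral_mono fun z => ?_
        by_cases hz : z ∈ ball x 1
        · have hx : x ∈ ball z 1 := by rwa [mem_ball_comm]
          rw [Set.indicator_of_mem hz, Set.indicator_of_mem hx]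
          gcongr
          refine hA x z ?_
          rw [← dist_eq_norm]
          exact (mem_ball.1 hx).le
        · have hx : x ∉ ball z 1 := by rwa [mem_ball_comm]
          rw [Set.indicator_of_notMem hz, Set.indicator_of_notMem hx, mul_zero]
    _ = ∫⁻ x, A * volume (ball (0 : EuclideanSpace ℝ (Fin d)) 1) * (w x * σ x) := by
        refine lintegral_congr fun x => ?_
        rw [setLIntegral_const, Measure.addHaar_ball_center]
        ring
    _ = _ := lintegral_const_mul _ (hw.mul hσ)

/-- The cut off, smoothed multilinear Kakeya integrand at the endpoint exponent. -/
noncomputable def smoothedIntegrand {n : ℕ} (k : ℕ)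
    (𝕋 : Fin (n + 1) →
      Finset (EuclideanSpace ℝ (Fin (n + 1)) × EuclideanSpace ℝ (Fin (n + 1))))
    (x : EuclideanSpace ℝ (Fin (n + 1))) : ℝ≥0∞ :=
  cutoffWeight k x * ∏ j, (∑ T ∈ 𝕋 j, tubeWeight T.1 T.2 x) ^ (n : ℝ)⁻¹

theorem measurable_smoothedIntegrand {n : ℕ} (k : ℕ)
    (𝕋 : Fin (n + 1) →
      Finset (EuclideanSpace ℝ (Fin (n + 1)) × EuclideanSpace ℝ (Fin (n + 1)))) :
    Measurable (smoothedIntegrand k 𝕋) :=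
  (measurable_cutoffWeight k).mul (Finset.measurable_prod _ fun _ _ =>
    (Finset.measurable_sum _ fun T _ => measurable_tubeWeight T.1 T.2).pow_const _)

theorem smoothedIntegrand_le {n : ℕ} (k : ℕ)
    (𝕋 : Fin (n + 1) →
      Finset (EuclideanSpace ℝ (Fin (n + 1)) × EuclideanSpace ℝ (Fin (n + 1))))
    (x z : EuclideanSpace ℝ (Fin (n + 1))) (h : ‖x - z‖ ≤ 1) :
    smoothedIntegrand k 𝕋 z ≤ (2 ^ (n + 1 + 1) * ((2 ^ (n + 1 + 1)) ^ (n : ℝ)⁻¹) ^ (n + 1)) *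
      smoothedIntegrand k 𝕋 x := by
  have h1 : ∏ j, (∑ T ∈ 𝕋 j, tubeWeight T.1 T.2 z) ^ (n : ℝ)⁻¹ ≤
      ((2 ^ (n + 1 + 1)) ^ (n : ℝ)⁻¹) ^ (n + 1) *
        ∏ j, (∑ T ∈ 𝕋 j, tubeWeight T.1 T.2 x) ^ (n : ℝ)⁻¹ := by
    calc ∏ j, (∑ T ∈ 𝕋 j, tubeWeight T.1 T.2 z) ^ (n : ℝ)⁻¹
        ≤ ∏ j, ((2 ^ (n + 1 + 1)) ^ (n : ℝ)⁻¹ *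
            (∑ T ∈ 𝕋 j, tubeWeight T.1 T.2 x) ^ (n : ℝ)⁻¹) := by
          refine Finset.prod_le_prod' fun _ _ => ?_
          rw [← ENNReal.mul_rpow_of_nonneg _ _ (by positivity), Finset.mul_sum]
          gcongr with T hT
          exact tubeWeight_le _ _ x z h
      _ = _ := by rw [Finset.prod_mul_distrib]; simp
  calc smoothedIntegrand k 𝕋 z ≤ (2 ^ (n + 1 + 1) * cutoffWeight k x) *
        (((2 ^ (n + 1 + 1)) ^ (n : ℝ)⁻¹) ^ (n + 1) *
          ∏ j, (∑ T ∈ 𝕋 j, tubeWeight T.1 T.2 x) ^ (n : ℝ)⁻¹) :=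
        mul_le_mul' (cutoffWeight_le k x z h) h1
    _ = _ := by
        rw [smoothedIntegrand]
        ring

theorem lintegral_smoothedIntegrand_lt_top {n : ℕ} (k : ℕ)
    (𝕋 : Fin (n + 1) →
      Finset (EuclideanSpace ℝ (Fin (n + 1)) × EuclideanSpace ℝ (Fin (n + 1))))
    (h𝕋 : ∀ j, ∀ T ∈ 𝕋 j, ‖T.2‖ = 1) : ∫⁻ x, smoothedIntegrand k 𝕋 x < ∞ := by
  obtain ⟨K, hK, hKle⟩ := exists_tubeWeight_le (d := n + 1) (by omega)
  calc ∫⁻ x, smoothedIntegrand k 𝕋 x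
      ≤ ∫⁻ x : EuclideanSpace ℝ (Fin (n + 1)), cutoffWeight k x *
          ∏ j, ((𝕋 j).card * K) ^ (n : ℝ)⁻¹ := by
        refine lintegral_mono fun x => ?_
        rw [smoothedIntegrand]
        gcongr
        rw [← nsmul_eq_mul]
        exact Finset.sum_le_card_nsmul _ _ _ fun T hT => hKle _ _ _ (h𝕋 _ T hT)
    _ = (∫⁻ x : EuclideanSpace ℝ (Fin (n + 1)), cutoffWeight k x) *
          ∏ j, ((𝕋 j).card * K) ^ (n : ℝ)⁻¹ := lintegral_mul_const _ (measurable_cutoffWeight k)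
    _ < ∞ := by
        refine ENNReal.mul_lt_top (lintegral_cutoffWeight_lt_top k) (ENNReal.prod_lt_top fun j _ => ?_)
        exact ENNReal.rpow_lt_top_of_nonneg (by positivity) (ENNReal.mul_ne_top (by simp) hK)

theorem measurable_lintegral_ball {d : ℕ} (σ : EuclideanSpace ℝ (Fin d) → ℝ≥0∞)
    (hσ : Measurable σ) : Measurable fun z => ∫⁻ x in ball z 1, σ x := by
  have hD : MeasurableSet {p : EuclideanSpace ℝ (Fin d) × EuclideanSpace ℝ (Fin d) |
      dist p.2 p.1 < 1} := measurableSet_lt (by fun_prop) measurable_const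
  have hm : Measurable fun p : EuclideanSpace ℝ (Fin d) × EuclideanSpace ℝ (Fin d) =>
      (ball p.1 1).indicator σ p.2 := (hσ.comp measurable_snd).indicator hD
  have h := hm.lintegral_prod_right' (ν := volume)
  simpa only [lintegral_indicator measurableSet_ball] using h

theorem setLIntegral_tubeWeight_mul_le {d : ℕ} (a e : EuclideanSpace ℝ (Fin d))
    (σ : EuclideanSpace ℝ (Fin d) → ℝ≥0∞) (hσ : Measurable σ) (Λ K : ℝ≥0∞)
    (hΛ : ∀ x, ∫⁻ t : ℝ, σ (x + t • e) ≤ Λ) (hK : ∀ x, tubeWeight a e x ≤ K)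
    (s : Set (EuclideanSpace ℝ (Fin d))) :
    ∫⁻ z in s, tubeWeight a e z * ((∫⁻ x in ball z 1, σ x) + 1) ≤
      2 ^ (d + 1) * volume (ball (0 : EuclideanSpace ℝ (Fin d)) 1) *
        ((∫⁻ x : EuclideanSpace ℝ (Fin d), decayWeight x) * Λ) + K * volume s := by
  have hw := measurable_tubeWeight a e
  calc ∫⁻ z in s, tubeWeight a e z * ((∫⁻ x in ball z 1, σ x) + 1)
      = (∫⁻ z in s, tubeWeight a e z * ∫⁻ x in ball z 1, σ x) + ∫⁻ z in s, tubeWeight a e z := by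
        rw [← lintegral_add_right _ hw]
        simp only [mul_add, mul_one]
    _ ≤ (∫⁻ z, tubeWeight a e z * ∫⁻ x in ball z 1, σ x) + ∫⁻ _ in s, K :=
        add_le_add (setLIntegral_le_lintegral _ _) (lintegral_mono hK)
    _ ≤ _ := by
        rw [setLIntegral_const]
        gcongr
        refine (lintegral_mul_lintegral_ball_le _ σ hw hσ _ fun x z => tubeWeight_le a e x z).trans ?_
        gcongr
        exact lintegral_tubeWeight_mul_le a e σ hσ Λ hΛ

theorem mul_mul_prod_rpow_le {n : ℕ} (hn : 1 ≤ n) (l g B : ℝ≥0∞) (F a : Fin (n + 1) → ℝ≥0∞)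
    (hg : g ≤ 1) (h : l * (g * ∏ j, F j ^ (n : ℝ)⁻¹) * ∏ j, F j ≤ B * ∏ j, a j) :
    l ^ ((n : ℝ) + 1)⁻¹ * (g * ∏ j, F j ^ (n : ℝ)⁻¹) ≤
      B ^ ((n : ℝ) + 1)⁻¹ * ∏ j, a j ^ ((n : ℝ) + 1)⁻¹ := by
  have hn0 : (0 : ℝ) < n := by exact_mod_cast hn
  have hq : 0 ≤ ((n : ℝ) + 1)⁻¹ := by positivity
  have hq1 : ((n : ℝ) + 1)⁻¹ ≤ 1 := inv_le_one_of_one_le₀ (by linarith)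
  have hF : ∀ j, F j ^ (n : ℝ)⁻¹ = (F j ^ (n : ℝ)⁻¹ * F j) ^ ((n : ℝ) + 1)⁻¹ := fun j => by
    nth_rewrite 3 [← ENNReal.rpow_one (F j)]
    rw [← ENNReal.rpow_add_of_nonneg _ _ (by positivity) zero_le_one, ← ENNReal.rpow_mul]
    congr 1
    field_simp
    ring
  calc l ^ ((n : ℝ) + 1)⁻¹ * (g * ∏ j, F j ^ (n : ℝ)⁻¹)
      ≤ l ^ ((n : ℝ) + 1)⁻¹ * (g ^ ((n : ℝ) + 1)⁻¹ *
          ∏ j, (F j ^ (n : ℝ)⁻¹ * F j) ^ ((n : ℝ) + 1)⁻¹) := by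
        rw [← Finset.prod_congr rfl fun j _ => hF j]
        gcongr
        simpa using ENNReal.rpow_le_rpow_of_exponent_ge hg hq1
    _ = (l * (g * ∏ j, F j ^ (n : ℝ)⁻¹) * ∏ j, F j) ^ ((n : ℝ) + 1)⁻¹ := by
        rw [ENNReal.prod_rpow_of_nonneg hq, ← ENNReal.mul_rpow_of_nonneg _ _ hq,
          ← ENNReal.mul_rpow_of_nonneg _ _ hq, Finset.prod_mul_distrib]
        congr 1
        ring
    _ ≤ (B * ∏ j, a j) ^ ((n : ℝ) + 1)⁻¹ := ENNReal.rpow_le_rpow h hq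
    _ = _ := by
        rw [ENNReal.mul_rpow_of_nonneg _ _ hq, ENNReal.prod_rpow_of_nonneg hq]

theorem exists_setLIntegral_smoothedIntegrand_le (n : ℕ) (hn : 1 ≤ n) {c : ℝ} (hc : 0 < c) :
    ∃ C : ℝ≥0∞, C ≠ ∞ ∧ ∀ (k : ℕ) (𝕋 : Fin (n + 1) →
        Finset (EuclideanSpace ℝ (Fin (n + 1)) × EuclideanSpace ℝ (Fin (n + 1)))),
      (∀ j, ∀ T ∈ 𝕋 j, ‖T.2‖ = 1) →
      (∀ T : (j : Fin (n + 1)) →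
          EuclideanSpace ℝ (Fin (n + 1)) × EuclideanSpace ℝ (Fin (n + 1)),
        (∀ j, T j ∈ 𝕋 j) →
        c ≤ |Matrix.det (Matrix.of fun i j => (T j).2 i)|) →
      ∫⁻ x, smoothedIntegrand k 𝕋 x ≠ 0 → ∀ R : ℝ,
      ∫⁻ x in ball 0 R, smoothedIntegrand k 𝕋 x ≤
        C * (∫⁻ x, smoothedIntegrand k 𝕋 x) ^ ((n : ℝ) + 1)⁻¹ *
          ∏ j, ((𝕋 j).card : ℝ≥0∞) ^ ((n : ℝ) + 1)⁻¹ := by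
  obtain ⟨C₀, hC₀, hvar⟩ := exists_le_prod_directional_variation (n + 1) hc
  obtain ⟨L, hL, hmap⟩ := exists_directed_sphere_map
  obtain ⟨K, hK, hKle⟩ := exists_tubeWeight_le (d := n + 1) (by omega)
  set A : ℝ≥0∞ := 2 ^ (n + 1 + 1) * ((2 ^ (n + 1 + 1)) ^ (n : ℝ)⁻¹) ^ (n + 1) with hA
  have hAtop : A ≠ ∞ := by
    refine ENNReal.mul_ne_top (by simp) (ENNReal.pow_ne_top ?_)
    exact ENNReal.rpow_ne_top_of_nonneg (by positivity) (by simp)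
  have hA0 : A ≠ 0 := by
    refine mul_ne_zero (by simp) (pow_ne_zero _ ?_)
    exact (ENNReal.rpow_pos (by positivity) (by simp)).ne'
  set V := volume (ball (0 : EuclideanSpace ℝ (Fin (n + 1))) 1) with hV
  set H := ∫⁻ x : EuclideanSpace ℝ (Fin (n + 1)), decayWeight x with hH
  set q : ℝ := ((n : ℝ) + 1)⁻¹ with hq
  have hq0 : 0 < q := by positivity
  set C₂ : ℝ≥0∞ := 2 ^ (n + 1 + 1) * V * (H * ENNReal.ofReal (L * (n + 1))) + 1 with hC₂
  refine ⟨(ENNReal.ofReal C₀ * A) ^ q * C₂, ?_, fun k 𝕋 h𝕋 hdet hS R => ?_⟩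
  · refine ENNReal.mul_ne_top (ENNReal.rpow_ne_top_of_nonneg hq0.le
      (ENNReal.mul_ne_top (by simp) hAtop)) (ENNReal.add_ne_top.2 ⟨?_, by simp⟩)
    exact ENNReal.mul_ne_top (ENNReal.mul_ne_top (by simp) measure_ball_lt_top.ne)
      (ENNReal.mul_ne_top lintegral_decayWeight_lt_top.ne (by simp))
  set G := smoothedIntegrand k 𝕋 with hG
  have hGm : Measurable G := measurable_smoothedIntegrand k 𝕋
  set S := ∫⁻ x, G x with hSdef
  have hStop : S ≠ ∞ := (lintegral_smoothedIntegrand_lt_top k 𝕋 h𝕋).ne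
  obtain ⟨D, hD1, hDK⟩ : ∃ D : ℕ, 1 ≤ D ∧
      K * volume (ball (0 : EuclideanSpace ℝ (Fin (n + 1))) R) ≤ D := by
    obtain ⟨D, hD⟩ := ENNReal.exists_nat_gt (r := K *
      volume (ball (0 : EuclideanSpace ℝ (Fin (n + 1))) R))
      (ENNReal.mul_ne_top hK measure_ball_lt_top.ne)
    refine ⟨D + 1, by omega, hD.le.trans ?_⟩
    push_cast
    exact le_self_add
  have hD0 : (D : ℝ≥0∞) ≠ 0 := by
    simp
    omega
  set l : ℝ≥0∞ := (D : ℝ≥0∞) ^ (n + 1) / S with hl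
  have hltop : l ≠ ∞ := ENNReal.div_ne_top (by simp) hS
  have hl0 : l ≠ 0 := (ENNReal.div_pos (pow_ne_zero _ hD0) hStop).ne'
  have hlq : l ^ q = D / S ^ q := by
    rw [hl, ENNReal.div_rpow_of_nonneg _ _ hq0.le, ← ENNReal.rpow_natCast, ← ENNReal.rpow_mul]
    push_cast
    rw [hq, mul_inv_cancel₀ (by positivity), ENNReal.rpow_one]
  set μ : Measure (EuclideanSpace ℝ (Fin (n + 1))) :=
    (volume.restrict (ball 0 (R + 1))).withDensity fun x => l * G x with hμ
  have hμuniv : μ Set.univ ≤ (D : ℝ≥0∞) ^ (n + 1) := by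
    rw [hμ, withDensity_apply _ MeasurableSet.univ, Measure.restrict_univ]
    refine (setLIntegral_le_lintegral _ _).trans ?_
    rw [lintegral_const_mul _ hGm, ← hSdef, hl, ENNReal.div_mul_cancel hS hStop]
  have : IsFiniteMeasure μ := ⟨hμuniv.trans_lt (by simp)⟩
  have hac : μ ≪ volume := (withDensity_absolutelyContinuous _ _).trans
    Measure.restrict_le_self.absolutelyContinuous
  have hR : ∀ᵐ x ∂μ, ‖x‖ ≤ R + 1 := by
    refine (withDensity_absolutelyContinuous _ _).ae_le ?_
    filter_upwards [ae_restrict_mem measurableSet_ball] with x hx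
    exact (mem_ball_zero_iff.1 hx).le
  obtain ⟨κ, _, γ, hγ, hγ1, hγμ, hγL⟩ := hmap (n + 1) D μ hac (R + 1) hR hμuniv
  have hσ : ∀ e : EuclideanSpace ℝ (Fin (n + 1)), Measurable fun x => ‖fderiv ℝ γ x e‖ₑ :=
    fun e => ((hγ.continuous_fderiv (by norm_num)).clm_apply continuous_const).measurable.enorm
  set a : Fin (n + 1) → EuclideanSpace ℝ (Fin (n + 1)) → ℝ≥0∞ := fun j z =>
    ∑ T ∈ 𝕋 j, tubeWeight T.1 T.2 z * ((∫⁻ x in ball z 1, ‖fderiv ℝ γ x T.2‖ₑ) + 1) with ha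
  have ham : ∀ j, Measurable (a j) := fun j => Finset.measurable_sum _ fun T _ =>
    (measurable_tubeWeight _ _).mul ((measurable_lintegral_ball _ (hσ T.2)).add_const 1)
  have hpt : ∀ z ∈ ball (0 : EuclideanSpace ℝ (Fin (n + 1))) R,
      l ^ q * G z ≤ (ENNReal.ofReal C₀ * A) ^ q * ∏ j, a j z ^ q := by
    intro z hz
    refine mul_mul_prod_rpow_le hn l (cutoffWeight k z) _ _ _ (min_le_left _ _) ?_
    refine mul_prod_sum_le 𝕋 (fun T => tubeWeight T.1 T.2 z)
      (fun T => (∫⁻ x in ball z 1, ‖fderiv ℝ γ x T.2‖ₑ) + 1) _ _ fun T hT => ?_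
    have hle : (A⁻¹ * (l * G z)) • volume.restrict (ball z 1) ≤ μ := by
      refine Measure.le_iff.2 fun s hs => ?_
      rw [hμ, withDensity_apply _ hs, Measure.restrict_restrict hs, Measure.smul_apply, smul_eq_mul,
        Measure.restrict_apply hs, ← setLIntegral_const]
      calc ∫⁻ _ in s ∩ ball z 1, A⁻¹ * (l * G z) ≤ ∫⁻ x in s ∩ ball z 1, l * G x := by
            refine setLIntegral_mono' (hs.inter measurableSet_ball) fun x hx => ?_
            rw [ENNReal.inv_mul_le_iff hA0 hAtop, mul_left_comm]
            gcongr
            refine smoothedIntegrand_le k 𝕋 x z ?_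
            rw [← dist_eq_norm]
            exact (mem_ball.1 hx.2).le
        _ ≤ ∫⁻ x in s ∩ ball 0 (R + 1), l * G x := by
            refine lintegral_mono_set (Set.inter_subset_inter_right _ (ball_subset_ball' ?_))
            linarith [mem_ball.1 hz]
    have h := hvar κ γ μ z (A⁻¹ * (l * G z)) (fun j => (T j).2) hγ hγ1 hγμ hle
      (fun j => h𝕋 j _ (hT j)) (hdet T hT)
    rw [ENNReal.inv_mul_le_iff hA0 hAtop] at h
    refine h.trans_eq ?_
    ring
  have haint : ∀ j, ∫⁻ z in ball 0 R, a j z ≤ (𝕋 j).card * (C₂ * D) := by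
    intro j
    rw [ha, lintegral_finsetSum' _ (fun T _ => ((measurable_tubeWeight _ _).mul
      ((measurable_lintegral_ball _ (hσ T.2)).add_const 1)).aemeasurable), ← nsmul_eq_mul]
    refine Finset.sum_le_card_nsmul _ _ _ fun T hT => ?_
    refine (setLIntegral_tubeWeight_mul_le T.1 T.2 _ (hσ T.2) _ K (fun x => hγL x T.2)
      (fun x => hKle _ _ _ (h𝕋 j T hT)) (ball 0 R)).trans ?_
    rw [hC₂, add_mul, one_mul]
    refine add_le_add (le_of_eq ?_) hDK
    have : ENNReal.ofReal (L * ((n + 1 : ℕ) * D)) = ENNReal.ofReal (L * (n + 1)) * D := by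
      rw [← ENNReal.ofReal_natCast, ← ENNReal.ofReal_mul (by positivity)]
      push_cast
      ring_nf
    rw [this]
    ring
  have hmain : l ^ q * ∫⁻ z in ball 0 R, G z ≤
      (ENNReal.ofReal C₀ * A) ^ q * ((C₂ * D) * ∏ j, ((𝕋 j).card : ℝ≥0∞) ^ q) := by
    calc l ^ q * ∫⁻ z in ball 0 R, G z = ∫⁻ z in ball 0 R, l ^ q * G z :=
          (lintegral_const_mul _ hGm).symm
      _ ≤ ∫⁻ z in ball 0 R, (ENNReal.ofReal C₀ * A) ^ q * ∏ j, a j z ^ q :=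
          setLIntegral_mono' measurableSet_ball hpt
      _ = (ENNReal.ofReal C₀ * A) ^ q * ∫⁻ z in ball 0 R, ∏ j, a j z ^ q :=
          lintegral_const_mul _ (Finset.measurable_prod _ fun j _ => (ham j).pow_const _)
      _ ≤ (ENNReal.ofReal C₀ * A) ^ q * ∏ j, (∫⁻ z in ball 0 R, a j z) ^ q := by
          gcongr
          refine ENNReal.lintegral_prod_norm_pow_le _ (fun j _ => (ham j).aemeasurable) ?_
            fun _ _ => hq0.le
          simp [hq]
          field_simp
      _ ≤ (ENNReal.ofReal C₀ * A) ^ q * ∏ j, ((𝕋 j).card * (C₂ * D)) ^ q := by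
          gcongr with j
          exact haint j
      _ = _ := by
          congr 1
          simp only [ENNReal.mul_rpow_of_nonneg _ (C₂ * D) hq0.le, Finset.prod_mul_distrib]
          rw [mul_comm, Finset.prod_const, Finset.card_univ, Fintype.card_fin,
            ← ENNReal.rpow_natCast, ← ENNReal.rpow_mul]
          push_cast
          rw [hq, inv_mul_cancel₀ (by positivity), ENNReal.rpow_one]
  have hS0 : S ^ q ≠ 0 := (ENNReal.rpow_pos (pos_iff_ne_zero.2 hS) hStop).ne'
  have hSt : S ^ q ≠ ∞ := ENNReal.rpow_ne_top_of_nonneg hq0.le hStop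
  rw [hlq, ENNReal.div_eq_inv_mul, mul_assoc, ENNReal.inv_mul_le_iff hS0 hSt] at hmain
  rw [← ENNReal.mul_le_mul_iff_right hD0 (ENNReal.natCast_ne_top D)]
  refine hmain.trans_eq ?_
  ring

theorem exists_lintegral_smoothedIntegrand_le (n : ℕ) (hn : 1 ≤ n) {c : ℝ} (hc : 0 < c) :
    ∃ C : ℝ≥0∞, C ≠ ∞ ∧ ∀ (k : ℕ) (𝕋 : Fin (n + 1) →
        Finset (EuclideanSpace ℝ (Fin (n + 1)) × EuclideanSpace ℝ (Fin (n + 1)))),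
      (∀ j, ∀ T ∈ 𝕋 j, ‖T.2‖ = 1) →
      (∀ T : (j : Fin (n + 1)) →
          EuclideanSpace ℝ (Fin (n + 1)) × EuclideanSpace ℝ (Fin (n + 1)),
        (∀ j, T j ∈ 𝕋 j) →
        c ≤ |Matrix.det (Matrix.of fun i j => (T j).2 i)|) →
      ∫⁻ x, smoothedIntegrand k 𝕋 x ≤ C * ∏ j, ((𝕋 j).card : ℝ≥0∞) ^ (n : ℝ)⁻¹ := by
  obtain ⟨C, hC, h⟩ := exists_setLIntegral_smoothedIntegrand_le n hn hc
  have hn0 : (0 : ℝ) < n := by exact_mod_cast hn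
  refine ⟨C ^ (((n : ℝ) + 1) / n), ENNReal.rpow_ne_top_of_nonneg (by positivity) hC,
    fun k 𝕋 h𝕋 hdet => ?_⟩
  set S := ∫⁻ x, smoothedIntegrand k 𝕋 x with hS
  have hStop : S ≠ ∞ := (lintegral_smoothedIntegrand_lt_top k 𝕋 h𝕋).ne
  obtain hS0 | hS0 := eq_or_ne S 0
  · rw [hS0]
    exact zero_le
  set q : ℝ := ((n : ℝ) + 1)⁻¹ with hq
  have hq0 : 0 < q := by positivity
  have h1 : S ≤ C * S ^ q * ∏ j, ((𝕋 j).card : ℝ≥0∞) ^ q := by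
    have h2 : S = ⨆ m : ℕ, ∫⁻ x in ball 0 (m : ℝ), smoothedIntegrand k 𝕋 x := by
      rw [← setLIntegral_iUnion_of_directed, iUnion_ball_nat, setLIntegral_univ]
      exact (monotone_nat_of_le_succ fun m => ball_subset_ball (by simp)).directed_le
    rw [h2]
    refine iSup_le fun m => ?_
    rw [← h2]
    exact h k 𝕋 h𝕋 hdet hS0 m
  have hSq0 : S ^ q ≠ 0 := (ENNReal.rpow_pos (pos_iff_ne_zero.2 hS0) hStop).ne'
  have hSqt : S ^ q ≠ ∞ := ENNReal.rpow_ne_top_of_nonneg hq0.le hStop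
  have h3 : S ^ (1 - q) ≤ C * ∏ j, ((𝕋 j).card : ℝ≥0∞) ^ q := by
    rw [ENNReal.rpow_sub _ _ hS0 hStop, ENNReal.rpow_one, ENNReal.div_le_iff hSq0 hSqt]
    refine h1.trans_eq ?_
    ring
  have h4 : (1 - q) * (((n : ℝ) + 1) / n) = 1 := by
    rw [hq]
    field_simp
    ring
  have h5 : q * (((n : ℝ) + 1) / n) = (n : ℝ)⁻¹ := by
    rw [hq]
    field_simp
  calc S = (S ^ (1 - q)) ^ (((n : ℝ) + 1) / n) := by rw [← ENNReal.rpow_mul, h4, ENNReal.rpow_one]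
    _ ≤ (C * ∏ j, ((𝕋 j).card : ℝ≥0∞) ^ q) ^ (((n : ℝ) + 1) / n) :=
        ENNReal.rpow_le_rpow h3 (by positivity)
    _ = _ := by
        rw [ENNReal.mul_rpow_of_nonneg _ _ (by positivity),
          ← ENNReal.prod_rpow_of_nonneg (by positivity)]
        simp only [← ENNReal.rpow_mul, h5]

theorem exists_lintegral_prod_infTube_one_le (n : ℕ) (hn : 1 ≤ n) {c : ℝ} (hc : 0 < c) :
    ∃ C : ℝ≥0∞, C ≠ ∞ ∧ ∀ 𝕋 : Fin (n + 1) →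
        Finset (EuclideanSpace ℝ (Fin (n + 1)) × EuclideanSpace ℝ (Fin (n + 1))),
      (∀ j, ∀ T ∈ 𝕋 j, ‖T.2‖ = 1) →
      (∀ T : (j : Fin (n + 1)) →
          EuclideanSpace ℝ (Fin (n + 1)) × EuclideanSpace ℝ (Fin (n + 1)),
        (∀ j, T j ∈ 𝕋 j) →
        c ≤ |Matrix.det (Matrix.of fun i j => (T j).2 i)|) →
      ∫⁻ x, ∏ j, (∑ T ∈ 𝕋 j,
          (infTube 1 T.1 T.2).indicator (fun _ => (1 : ℝ≥0∞)) x) ^ (n : ℝ)⁻¹ ≤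
        C * ∏ j, ((𝕋 j).card : ℝ≥0∞) ^ (n : ℝ)⁻¹ := by
  obtain ⟨C, hC, h⟩ := exists_lintegral_smoothedIntegrand_le n hn hc
  have hp : 0 ≤ (n : ℝ)⁻¹ := by positivity
  set B : ℝ≥0∞ := ((3 ^ (n + 1 + 1)) ^ (n : ℝ)⁻¹) ^ (n + 1) with hB
  have hBtop : B ≠ ∞ := ENNReal.pow_ne_top (ENNReal.rpow_ne_top_of_nonneg hp (by simp))
  refine ⟨B * C, ENNReal.mul_ne_top hBtop hC, fun 𝕋 h𝕋 hdet => ?_⟩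
  have hpt : ∀ x, ∏ j, (∑ T ∈ 𝕋 j,
      (infTube 1 T.1 T.2).indicator (fun _ => (1 : ℝ≥0∞)) x) ^ (n : ℝ)⁻¹ ≤
        B * ⨆ k, smoothedIntegrand k 𝕋 x := by
    intro x
    simp only [smoothedIntegrand]
    rw [← ENNReal.iSup_mul, iSup_cutoffWeight, one_mul]
    calc _ ≤ ∏ j, ((3 ^ (n + 1 + 1)) ^ (n : ℝ)⁻¹ *
            (∑ T ∈ 𝕋 j, tubeWeight T.1 T.2 x) ^ (n : ℝ)⁻¹) := by
          refine Finset.prod_le_prod' fun j _ => ?_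
          rw [← ENNReal.mul_rpow_of_nonneg _ _ hp, Finset.mul_sum]
          gcongr with T hT
          exact infTube_indicator_le _ _ x (h𝕋 j T hT)
      _ = _ := by
        rw [Finset.prod_mul_distrib]
        simp [hB]
  calc _ ≤ ∫⁻ x, B * ⨆ k, smoothedIntegrand k 𝕋 x := lintegral_mono hpt
    _ = B * ⨆ k, ∫⁻ x, smoothedIntegrand k 𝕋 x := by
        rw [lintegral_const_mul _ (.iSup fun k => measurable_smoothedIntegrand k 𝕋),
          lintegral_iSup (fun k => measurable_smoothedIntegrand k 𝕋)]
        intro k l hkl x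
        exact mul_le_mul_left (monotone_cutoffWeight x hkl) _
    _ ≤ _ := by
        rw [mul_assoc]
        gcongr
        exact iSup_le fun k => h k 𝕋 h𝕋 hdet

theorem infTube_one_smul_mem_iff {d : ℕ} {δ : ℝ} (hδ : 0 < δ) (a e x : EuclideanSpace ℝ (Fin d)) :
    x ∈ infTube 1 (δ⁻¹ • a) e ↔ δ • x ∈ infTube δ a e := by
  have h : δ • x - a - ⟪δ • x - a, e⟫_ℝ • e =
      δ • (x - δ⁻¹ • a - ⟪x - δ⁻¹ • a, e⟫_ℝ • e) := by
    have h1 : δ • x - a = δ • (x - δ⁻¹ • a) := by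
      rw [smul_sub, smul_inv_smul₀ hδ.ne']
    rw [h1, real_inner_smul_left, mul_smul, ← smul_sub]
  rw [infTube, infTube, Set.mem_ofPred_eq, Set.mem_ofPred_eq, h, norm_smul, Real.norm_of_nonneg hδ.le]
  exact (mul_le_iff_le_one_right hδ).symm

theorem lintegral_eq_mul_lintegral_comp_smul {d : ℕ} {δ : ℝ} (hδ : 0 < δ)
    (f : EuclideanSpace ℝ (Fin d) → ℝ≥0∞) :
    ∫⁻ x, f x = ENNReal.ofReal δ ^ d * ∫⁻ x, f (δ • x) := by
  have h := Measure.map_addHaar_smul (volume : Measure (EuclideanSpace ℝ (Fin d))) hδ.ne'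
  have h1 : ∫⁻ x, f (δ • x) = ∫⁻ x, f x ∂(Measure.map (δ • ·) volume) :=
    (lintegral_map_equiv f (Homeomorph.smulOfNeZero δ hδ.ne').toMeasurableEquiv).symm
  rw [h1, h, lintegral_smul_measure, smul_eq_mul, ← mul_assoc, ← ENNReal.ofReal_pow hδ.le,
    ← ENNReal.ofReal_mul (by positivity), finrank_euclideanSpace_fin, abs_of_nonneg (by positivity),
    mul_inv_cancel₀ (by positivity), ENNReal.ofReal_one, one_mul]

theorem exists_lintegral_prod_infTube_le (n : ℕ) (hn : 1 ≤ n) {c : ℝ} (hc : 0 < c) :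
    ∃ C : ℝ≥0∞, C ≠ ∞ ∧ ∀ δ : ℝ, 0 < δ → ∀ 𝕋 : Fin (n + 1) →
        Finset (EuclideanSpace ℝ (Fin (n + 1)) × EuclideanSpace ℝ (Fin (n + 1))),
      (∀ j, ∀ T ∈ 𝕋 j, ‖T.2‖ = 1) →
      (∀ T : (j : Fin (n + 1)) →
          EuclideanSpace ℝ (Fin (n + 1)) × EuclideanSpace ℝ (Fin (n + 1)),
        (∀ j, T j ∈ 𝕋 j) →
        c ≤ |Matrix.det (Matrix.of fun i j => (T j).2 i)|) →
      ∫⁻ x, ∏ j, (∑ T ∈ 𝕋 j,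
          (infTube δ T.1 T.2).indicator (fun _ => (1 : ℝ≥0∞)) x) ^ (n : ℝ)⁻¹ ≤
        ENNReal.ofReal δ ^ (n + 1) * (C * ∏ j, ((𝕋 j).card : ℝ≥0∞) ^ (n : ℝ)⁻¹) := by
  obtain ⟨C, hC, h⟩ := exists_lintegral_prod_infTube_one_le n hn hc
  refine ⟨C, hC, fun δ hδ 𝕋 h𝕋 hdet => ?_⟩
  let ψ : EuclideanSpace ℝ (Fin (n + 1)) × EuclideanSpace ℝ (Fin (n + 1)) ↪
      EuclideanSpace ℝ (Fin (n + 1)) × EuclideanSpace ℝ (Fin (n + 1)) :=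
    ⟨fun T => (δ⁻¹ • T.1, T.2), fun S T hST => by
      rw [Prod.mk.injEq] at hST
      exact Prod.ext (smul_right_injective _ (inv_ne_zero hδ.ne') hST.1) hST.2⟩
  have h1 := h (fun j => (𝕋 j).map ψ) (fun j T hT => by
    obtain ⟨S, hS, rfl⟩ := Finset.mem_map.1 hT
    exact h𝕋 j S hS) fun T hT => by
      choose S hS hST using fun j => Finset.mem_map.1 (hT j)
      have h2 : (fun i j => (T j).2 i) = fun i j => (S j).2 i := by
        ext i j
        rw [← hST]
        rfl
      rw [h2]
      exact hdet S hS
  simp only [Finset.sum_map, Finset.card_map] at h1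
  rw [lintegral_eq_mul_lintegral_comp_smul hδ]
  gcongr
  refine le_trans (le_of_eq (lintegral_congr fun x => ?_)) h1
  refine Finset.prod_congr rfl fun j _ => ?_
  congr 1
  refine Finset.sum_congr rfl fun T _ => ?_
  refine Set.indicator_eq_indicator ?_ rfl
  exact (infTube_one_smul_mem_iff hδ T.1 T.2 x).symm

/-- The `d`-linear Kakeya theorem of Bennett–Carbery–Tao (`q > d/(d-1)`) and Guth
(endpoint `q = d/(d-1)`), here with `d = n+1 ≥ 2`: for `c`-transversal finite families
`𝕋₁, …, 𝕋_d` of doubly-infinite `δ`-tubes (each tube recorded as a pair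
`(a, e)` of a point and a unit direction),
`(∫ ∏_j (∑_{T ∈ 𝕋_j} χ_T)^{q/d})^{d/q} ≤ C ∏_j δ^{d/q} #𝕋_j`, with `C = C(d,q,c)`
independent of `δ` and of the families; no angular separation is assumed. -/
theorem multilinear_kakeya (n : ℕ) (hn : 1 ≤ n) (c : ℝ) (hc : 0 < c) (q : ℝ)
    (hq : ((n : ℝ) + 1) / n ≤ q) :
    ∃ C > 0, ∀ δ : ℝ, 0 < δ →
      ∀ 𝕋 : Fin (n + 1) →
          Finset (EuclideanSpace ℝ (Fin (n + 1)) × EuclideanSpace ℝ (Fin (n + 1))),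
      (∀ j, ∀ T ∈ 𝕋 j, ‖T.2‖ = 1) →
      (∀ T : (j : Fin (n + 1)) →
          EuclideanSpace ℝ (Fin (n + 1)) × EuclideanSpace ℝ (Fin (n + 1)),
        (∀ j, T j ∈ 𝕋 j) →
        c ≤ |Matrix.det (Matrix.of fun i j => (T j).2 i)|) →
      (∫⁻ x, ∏ j, (∑ T ∈ 𝕋 j,
            (infTube δ T.1 T.2).indicator (fun _ => (1 : ℝ≥0∞)) x) ^ (q / ((n : ℝ) + 1)))
          ^ (((n : ℝ) + 1) / q)
        ≤ ENNReal.ofReal (C * ∏ j : Fin (n + 1),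
            δ ^ (((n : ℝ) + 1) / q) * ((𝕋 j).card : ℝ)) := by
  have hn0 : (0 : ℝ) < n := by exact_mod_cast hn
  have hq0 : 0 < q := lt_of_lt_of_le (by positivity) hq
  set p : ℝ := (n : ℝ)⁻¹ with hp
  set s : ℝ := q / ((n : ℝ) + 1) with hs
  set r : ℝ := ((n : ℝ) + 1) / q with hr
  have hp0 : 0 ≤ p := by positivity
  have hs0 : 0 < s := by positivity
  have hr0 : 0 < r := by positivity
  have hsr : s * r = 1 := by
    rw [hs, hr]
    field_simp
  have hps : p ≤ s := by
    rw [hp, hs, le_div_iff₀ (by positivity)]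
    rwa [div_eq_inv_mul] at hq
  obtain ⟨C, hC, h⟩ := exists_lintegral_prod_infTube_le n hn hc
  have hCr : C ^ r ≠ ∞ := ENNReal.rpow_ne_top_of_nonneg hr0.le hC
  refine ⟨(C ^ r).toReal + 1, by positivity, fun δ hδ 𝕋 h𝕋 hdet => ?_⟩
  have hpow : ∀ F : ℝ≥0∞, F ^ s = F ^ p * F ^ (s - p) := fun F => by
    rw [← ENNReal.rpow_add_of_nonneg _ _ hp0 (sub_nonneg.2 hps), add_sub_cancel]
  have hint : ∫⁻ x, ∏ j, (∑ T ∈ 𝕋 j,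
      (infTube δ T.1 T.2).indicator (fun _ => (1 : ℝ≥0∞)) x) ^ s ≤
        ENNReal.ofReal δ ^ (n + 1) * C * ∏ j, ((𝕋 j).card : ℝ≥0∞) ^ s := by
    calc _ ≤ ∫⁻ x, (∏ j, (∑ T ∈ 𝕋 j,
          (infTube δ T.1 T.2).indicator (fun _ => (1 : ℝ≥0∞)) x) ^ p) *
            ∏ j, ((𝕋 j).card : ℝ≥0∞) ^ (s - p) := by
          refine lintegral_mono fun x => ?_
          simp only [hpow, Finset.prod_mul_distrib]
          gcongr with j
          rw [← nsmul_one]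
          refine Finset.sum_le_card_nsmul _ _ _ fun T _ => ?_
          exact Set.indicator_le_self' (fun _ _ => zero_le) x
      _ = (∫⁻ x, ∏ j, (∑ T ∈ 𝕋 j,
          (infTube δ T.1 T.2).indicator (fun _ => (1 : ℝ≥0∞)) x) ^ p) *
            ∏ j, ((𝕋 j).card : ℝ≥0∞) ^ (s - p) :=
          lintegral_mul_const' _ _ (ENNReal.prod_ne_top fun j _ =>
            ENNReal.rpow_ne_top_of_nonneg (sub_nonneg.2 hps) (by simp))
      _ ≤ (ENNReal.ofReal δ ^ (n + 1) * (C * ∏ j, ((𝕋 j).card : ℝ≥0∞) ^ p)) *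
            ∏ j, ((𝕋 j).card : ℝ≥0∞) ^ (s - p) := by
          gcongr
          exact h δ hδ 𝕋 h𝕋 hdet
      _ = _ := by
          simp only [hpow, Finset.prod_mul_distrib]
          ring
  calc _ ≤ (ENNReal.ofReal δ ^ (n + 1) * C * ∏ j, ((𝕋 j).card : ℝ≥0∞) ^ s) ^ r :=
        ENNReal.rpow_le_rpow hint hr0.le
    _ = C ^ r * ∏ j : Fin (n + 1), ENNReal.ofReal (δ ^ r) * ((𝕋 j).card : ℝ≥0∞) := by
        rw [ENNReal.mul_rpow_of_nonneg _ _ hr0.le, ENNReal.mul_rpow_of_nonneg _ _ hr0.le,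
          ← ENNReal.prod_rpow_of_nonneg hr0.le, Finset.prod_mul_distrib,
          ← ENNReal.ofReal_rpow_of_pos hδ]
        simp only [← ENNReal.rpow_mul, hsr, ENNReal.rpow_one, Finset.prod_const, Finset.card_univ,
          Fintype.card_fin]
        rw [← ENNReal.rpow_natCast, ← ENNReal.rpow_natCast, ← ENNReal.rpow_mul,
          ← ENNReal.rpow_mul, mul_comm r]
        ring
    _ ≤ ENNReal.ofReal ((C ^ r).toReal + 1) *
          ∏ j : Fin (n + 1), ENNReal.ofReal (δ ^ r) * ((𝕋 j).card : ℝ≥0∞) := by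
        gcongr
        exact ENNReal.le_ofReal_iff_toReal_le hCr (by positivity) |>.2 (by linarith)
    _ = _ := by
        rw [ENNReal.ofReal_mul (by positivity),
          ENNReal.ofReal_prod_of_nonneg fun j _ => by positivity]
        congr 1
        refine Finset.prod_congr rfl fun j _ => ?_
        rw [ENNReal.ofReal_mul (by positivity), ENNReal.ofReal_natCast]
end
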